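/- Let b > 1/2. Then there exists a constant C > 0 such that for all spatial indices i ∈ {1,2,3} and all Schwartz functions u, v on ℝ^{1+3}, ‖Q_{0i}(u,v)‖_{Ḣ^{−1}_{t,x}} ≤ C‖u‖_{H^{1,b}}‖v‖_{H^{1,b}}. -/

import Mathlib

/-!
STATEMENT 5: Null form estimate for `Q_{0i}`:
`‖Q_{0i}(u,v)‖_{Ḣ^{−1}_{t,x}} ≲ ‖u‖_{H^{1,b}} ‖v‖_{H^{1,b}}` for `b > 1/2`.
-/

open MeasureTheory
open scoped FourierTransform

noncomputable section

/-- The spatial part of a spacetime point/frequency `ζ = (τ, ξ) ∈ ℝ^{1+3}`. -/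
def spacePart (ζ : EuclideanSpace ℝ (Fin 4)) : EuclideanSpace ℝ (Fin 3) :=
  (WithLp.equiv 2 (Fin 3 → ℝ)).symm fun i => ζ i.succ

/-- The wave-Sobolev norm `‖u‖_{H^{s,b}} = ‖⟨ξ⟩^s ⟨|τ|−|ξ|⟩^b û(τ,ξ)‖_{L²_{τ,ξ}}`. -/
def waveSobolevNorm (s b : ℝ) (u : EuclideanSpace ℝ (Fin 4) → ℂ) : ℝ :=
  (∫ ζ : EuclideanSpace ℝ (Fin 4),
      (1 + ‖spacePart ζ‖ ^ 2) ^ s * (1 + (|ζ 0| - ‖spacePart ζ‖) ^ 2) ^ b *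
        ‖𝓕 u ζ‖ ^ 2) ^ (1 / 2 : ℝ)

/-- Partial derivative of a function on `ℝ^{1+3}` in the `i`-th coordinate direction
(`i = 0` is the time direction `∂_t`). -/
def pderiv (i : Fin 4) (u : EuclideanSpace ℝ (Fin 4) → ℂ) (z : EuclideanSpace ℝ (Fin 4)) : ℂ :=
  fderiv ℝ u z (EuclideanSpace.single i 1)

/-- The classical null form `Q_{0i}(u,v) = ∂_t u ∂_i v − ∂_i u ∂_t v`, with the
spatial index `i ∈ {1,2,3}` encoded as `i : Fin 3` (spacetime index `i.succ`). -/
def nullFormQ0i (i : Fin 3) (u v : EuclideanSpace ℝ (Fin 4) → ℂ)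
    (z : EuclideanSpace ℝ (Fin 4)) : ℂ :=
  pderiv 0 u z * pderiv i.succ v z - pderiv i.succ u z * pderiv 0 v z

/-- The homogeneous spacetime Sobolev norm
`‖F‖_{Ḣ^σ_{t,x}} = ‖(τ²+|ξ|²)^{σ/2} F̂(τ,ξ)‖_{L²_{τ,ξ}}`; note `τ²+|ξ|² = ‖ζ‖²`. -/
def homSpacetimeNorm (σ : ℝ) (F : EuclideanSpace ℝ (Fin 4) → ℂ) : ℝ :=
  (∫ ζ : EuclideanSpace ℝ (Fin 4), ‖ζ‖ ^ (2 * σ) * ‖𝓕 F ζ‖ ^ 2) ^ (1 / 2 : ℝ)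

open scoped ENNReal

/-- Spacetime. -/
abbrev E4 := EuclideanSpace ℝ (Fin 4)

/-- Space. -/
abbrev E3 := EuclideanSpace ℝ (Fin 3)

theorem ennreal_mul_le_sq_add_sq (x y : ℝ≥0∞) : x * y ≤ x ^ 2 + y ^ 2 := by
  rcases le_total x y with h | h
  · calc x * y ≤ y * y := by gcongr
      _ = y ^ 2 := by ring
      _ ≤ _ := le_add_self
  · calc x * y ≤ x * x := by gcongr
      _ = x ^ 2 := by ring
      _ ≤ _ := le_self_add

theorem core_cs (F : E4 → E4 → ℝ≥0∞) (X : E4 → E4 → E4 → ℝ≥0∞)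
    (hF : ∀ ζ, Measurable (F ζ))
    (hX : Measurable fun p : E4 × E4 × E4 => X p.1 p.2.1 p.2.2)
    (h : ∀ ζ η η', F ζ η * F ζ η' = X ζ η η' * X ζ η' η) :
    ∫⁻ ζ, (∫⁻ η, F ζ η) ^ 2 ≤ 2 * ∫⁻ ζ, ∫⁻ η, ∫⁻ η', X ζ η η' ^ 2 := by
  have h1 : ∀ ζ, (∫⁻ η, F ζ η) ^ 2 ≤ 2 * ∫⁻ η, ∫⁻ η', X ζ η η' ^ 2 := by
    intro ζ
    have hXm : Measurable fun p : E4 × E4 => X ζ p.1 p.2 ^ 2 := by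
      have : Measurable fun p : E4 × E4 => (ζ, p.1, p.2) := by fun_prop
      exact (hX.comp this).pow_const 2
    have hXm' : Measurable fun p : E4 × E4 => X ζ p.2 p.1 ^ 2 := hXm.comp measurable_swap
    calc (∫⁻ η, F ζ η) ^ 2 = ∫⁻ η, ∫⁻ η', F ζ η * F ζ η' := by
          rw [sq, ← lintegral_mul_const _ (hF ζ)]
          congr 1; ext η
          rw [lintegral_const_mul _ (hF ζ)]
      _ ≤ ∫⁻ η, ∫⁻ η', (X ζ η η' ^ 2 + X ζ η' η ^ 2) := by
          refine lintegral_mono fun η => lintegral_mono fun η' => ?_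
          simp only [h]
          exact ennreal_mul_le_sq_add_sq _ _
      _ = ∫⁻ η, ((∫⁻ η', X ζ η η' ^ 2) + ∫⁻ η', X ζ η' η ^ 2) := by
          congr 1; ext η
          rw [lintegral_add_left]
          exact hXm.comp (measurable_prodMk_left)
      _ = (∫⁻ η, ∫⁻ η', X ζ η η' ^ 2) + ∫⁻ η, ∫⁻ η', X ζ η' η ^ 2 := by
          rw [lintegral_add_left]
          exact hXm.lintegral_prod_right'
      _ = 2 * ∫⁻ η, ∫⁻ η', X ζ η η' ^ 2 := by
          rw [lintegral_lintegral_swap (f := fun η η' => X ζ η' η ^ 2) hXm'.aemeasurable]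
          ring
  refine (lintegral_mono h1).trans_eq ?_
  rw [lintegral_const_mul' _ _ (by norm_num)]

/-- The weighted convolution bilinear form, squared `L²` norm. -/
def bil (K : E4 → E4 → ℝ≥0∞) (f g : E4 → ℝ≥0∞) : ℝ≥0∞ :=
  ∫⁻ ζ, (∫⁻ η, K η (ζ - η) * f η * g (ζ - η)) ^ 2

/-- squared `L²` norm -/
def sqn (f : E4 → ℝ≥0∞) : ℝ≥0∞ := ∫⁻ ζ, f ζ ^ 2

theorem bil_le_out (K : E4 → E4 → ℝ≥0∞) (f g : E4 → ℝ≥0∞)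
    (hK : Measurable fun p : E4 × E4 => K p.1 p.2) (hf : Measurable f) (hg : Measurable g)
    (C : ℝ≥0∞) (hC : ∀ ζ, ∫⁻ η, K η (ζ - η) ^ 2 ≤ C) :
    bil K f g ≤ 2 * C * sqn f * sqn g := by
  have hF : ∀ ζ, Measurable fun η => K η (ζ - η) * f η * g (ζ - η) := by
    intro ζ
    have : Measurable fun η => K η (ζ - η) :=
      hK.comp (g := fun p : E4 × E4 => K p.1 p.2) (f := fun η => (η, ζ - η)) (by fun_prop)
    fun_prop
  have hX : Measurable fun p : E4 × E4 × E4 =>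
      K p.2.1 (p.1 - p.2.1) * f p.2.2 * g (p.1 - p.2.2) := by
    have : Measurable fun p : E4 × E4 × E4 => K p.2.1 (p.1 - p.2.1) :=
      hK.comp (g := fun p : E4 × E4 => K p.1 p.2)
        (f := fun p : E4 × E4 × E4 => (p.2.1, p.1 - p.2.1)) (by fun_prop)
    fun_prop
  have h := core_cs (fun ζ η => K η (ζ - η) * f η * g (ζ - η))
    (fun ζ η η' => K η (ζ - η) * f η' * g (ζ - η')) hF hX (by intros; ring)
  refine h.trans ?_
  rw [mul_assoc, mul_assoc]
  gcongr
  calc ∫⁻ ζ, ∫⁻ η, ∫⁻ η', (K η (ζ - η) * f η' * g (ζ - η')) ^ 2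
      = ∫⁻ ζ, (∫⁻ η, K η (ζ - η) ^ 2) * ∫⁻ η', f η' ^ 2 * g (ζ - η') ^ 2 := by
        congr 1; ext ζ
        have : Measurable fun η => K η (ζ - η) :=
          hK.comp (g := fun p : E4 × E4 => K p.1 p.2) (f := fun η => (η, ζ - η)) (by fun_prop)
        rw [← lintegral_mul_const _ (by fun_prop)]
        congr 1; ext η
        rw [← lintegral_const_mul _ (by fun_prop)]
        congr 1; ext η'
        ring
    _ ≤ ∫⁻ ζ, C * ∫⁻ η', f η' ^ 2 * g (ζ - η') ^ 2 := by
        gcongr with ζ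
        exact hC ζ
    _ = C * ∫⁻ η', ∫⁻ ζ, f η' ^ 2 * g (ζ - η') ^ 2 := by
        have hm : Measurable fun p : E4 × E4 => f p.2 ^ 2 * g (p.1 - p.2) ^ 2 := by fun_prop
        rw [lintegral_const_mul _ hm.lintegral_prod_right', lintegral_lintegral_swap hm.aemeasurable]
    _ = C * (sqn f * sqn g) := by
        congr 1
        rw [sqn, ← lintegral_mul_const _ (by fun_prop)]
        congr 1; ext η
        rw [lintegral_const_mul _ (by fun_prop), lintegral_sub_right_eq_self (fun x => g x ^ 2) η, sqn]

theorem bil_le_left (K : E4 → E4 → ℝ≥0∞) (f g : E4 → ℝ≥0∞)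
    (hK : Measurable fun p : E4 × E4 => K p.1 p.2) (hf : Measurable f) (hg : Measurable g)
    (C : ℝ≥0∞) (hC : ∀ ζ₁, ∫⁻ ζ₂, K ζ₁ ζ₂ ^ 2 ≤ C) :
    bil K f g ≤ 2 * C * sqn f * sqn g := by
  have hF : ∀ ζ, Measurable fun η => K η (ζ - η) * f η * g (ζ - η) := by
    intro ζ
    have : Measurable fun η => K η (ζ - η) :=
      hK.comp (g := fun p : E4 × E4 => K p.1 p.2) (f := fun η => (η, ζ - η)) (by fun_prop)
    fun_prop
  have hX : Measurable fun p : E4 × E4 × E4 =>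
      K p.2.1 (p.1 - p.2.1) * f p.2.1 * g (p.1 - p.2.2) := by
    have : Measurable fun p : E4 × E4 × E4 => K p.2.1 (p.1 - p.2.1) :=
      hK.comp (g := fun p : E4 × E4 => K p.1 p.2)
        (f := fun p : E4 × E4 × E4 => (p.2.1, p.1 - p.2.1)) (by fun_prop)
    fun_prop
  have h := core_cs (fun ζ η => K η (ζ - η) * f η * g (ζ - η))
    (fun ζ η η' => K η (ζ - η) * f η * g (ζ - η')) hF hX (by intros; ring)
  refine h.trans ?_
  rw [mul_assoc, mul_assoc]
  gcongr
  have hm : Measurable fun p : E4 × E4 => (K p.2 (p.1 - p.2) * f p.2) ^ 2 := by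
    have : Measurable fun p : E4 × E4 => K p.2 (p.1 - p.2) :=
      hK.comp (g := fun p : E4 × E4 => K p.1 p.2)
        (f := fun p : E4 × E4 => (p.2, p.1 - p.2)) (by fun_prop)
    fun_prop
  calc ∫⁻ ζ, ∫⁻ η, ∫⁻ η', (K η (ζ - η) * f η * g (ζ - η')) ^ 2
      = ∫⁻ ζ, ∫⁻ η, (K η (ζ - η) * f η) ^ 2 * sqn g := by
        congr 1; ext ζ
        congr 1; ext η
        simp_rw [mul_pow _ (g _)]
        rw [lintegral_const_mul _ (by fun_prop), lintegral_sub_left_eq_self (fun x => g x ^ 2) ζ, sqn]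
    _ = (∫⁻ η, ∫⁻ ζ, (K η (ζ - η) * f η) ^ 2) * sqn g := by
        rw [← lintegral_lintegral_swap (f := fun ζ η => (K η (ζ - η) * f η) ^ 2) hm.aemeasurable,
          ← lintegral_mul_const _ hm.lintegral_prod_right']
        congr 1; ext ζ
        rw [lintegral_mul_const]
        exact hm.comp (measurable_prodMk_left)
    _ ≤ (∫⁻ η, C * f η ^ 2) * sqn g := by
        gcongr with η
        simp_rw [mul_pow]
        have hk : Measurable fun x => K η x := hK.comp (measurable_prodMk_left (x := η))
        rw [lintegral_mul_const _ (by fun_prop), lintegral_sub_right_eq_self (fun x => K η x ^ 2) η]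
        gcongr
        exact hC η
    _ = C * (sqn f * sqn g) := by
        rw [lintegral_const_mul _ (by fun_prop), mul_assoc, ← sqn]

theorem bil_swap (K : E4 → E4 → ℝ≥0∞) (f g : E4 → ℝ≥0∞) :
    bil K f g = bil (fun a b => K b a) g f := by
  unfold bil
  congr 1; ext ζ
  congr 1
  rw [← lintegral_sub_left_eq_self _ ζ]
  congr 1; ext η
  simp only [sub_sub_cancel]
  ring

theorem bil_le_right (K : E4 → E4 → ℝ≥0∞) (f g : E4 → ℝ≥0∞)
    (hK : Measurable fun p : E4 × E4 => K p.1 p.2) (hf : Measurable f) (hg : Measurable g)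
    (C : ℝ≥0∞) (hC : ∀ ζ₂, ∫⁻ ζ₁, K ζ₁ ζ₂ ^ 2 ≤ C) :
    bil K f g ≤ 2 * C * sqn f * sqn g := by
  rw [bil_swap]
  refine (bil_le_left (fun a b => K b a) g f (hK.comp measurable_swap) hg hf C hC).trans_eq ?_
  ring

theorem sq_add_le_three (x y : ℝ≥0∞) : (x + y) ^ 2 ≤ 3 * (x ^ 2 + y ^ 2) := by
  calc (x + y) ^ 2 = x ^ 2 + y ^ 2 + (x * y + x * y) := by ring
    _ ≤ x ^ 2 + y ^ 2 + ((x ^ 2 + y ^ 2) + (x ^ 2 + y ^ 2)) := by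
        gcongr <;> exact ennreal_mul_le_sq_add_sq _ _
    _ = 3 * (x ^ 2 + y ^ 2) := by ring

theorem bil_add (K K' : E4 → E4 → ℝ≥0∞) (f g : E4 → ℝ≥0∞)
    (hK : Measurable fun p : E4 × E4 => K p.1 p.2)
    (hf : Measurable f) (hg : Measurable g) :
    bil (fun a b => K a b + K' a b) f g ≤ 3 * (bil K f g + bil K' f g) := by
  have hm : Measurable fun p : E4 × E4 => K p.2 (p.1 - p.2) * f p.2 * g (p.1 - p.2) := by
    have : Measurable fun p : E4 × E4 => K p.2 (p.1 - p.2) :=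
      hK.comp (g := fun p : E4 × E4 => K p.1 p.2)
        (f := fun p : E4 × E4 => (p.2, p.1 - p.2)) (by fun_prop)
    fun_prop
  unfold bil
  rw [← lintegral_add_left (hm.lintegral_prod_right'.pow_const 2),
    ← lintegral_const_mul' _ _ (by norm_num)]
  refine lintegral_mono fun ζ => ?_
  refine le_trans (le_of_eq ?_) (sq_add_le_three _ _)
  simp only [add_mul]
  rw [lintegral_add_left]
  exact hm.comp measurable_prodMk_left

theorem bil_mono (K K' : E4 → E4 → ℝ≥0∞) (f g : E4 → ℝ≥0∞) (h : ∀ a b, K a b ≤ K' a b) :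
    bil K f g ≤ bil K' f g := by
  unfold bil
  gcongr
  apply h

theorem bil_const (c : ℝ≥0∞) (hc : c ≠ ∞) (K : E4 → E4 → ℝ≥0∞) (f g : E4 → ℝ≥0∞) :
    bil (fun a b => c * K a b) f g = c ^ 2 * bil K f g := by
  unfold bil
  rw [← lintegral_const_mul' _ _ (by finiteness)]
  congr 1; ext ζ
  rw [← mul_pow, ← lintegral_const_mul' _ _ hc]
  congr 2; ext η
  ring

/-- unweighted -/
def cv (f g : E4 → ℝ≥0∞) : ℝ≥0∞ := ∫⁻ ζ, (∫⁻ η, f η * g (ζ - η)) ^ 2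

theorem cv_eq (f g : E4 → ℝ≥0∞) : cv f g = bil (fun _ _ => 1) f g := by
  simp [cv, bil]

theorem cv_swap (f g : E4 → ℝ≥0∞) : cv f g = cv g f := by
  rw [cv_eq, bil_swap, cv_eq]

theorem cv_expand (f g : E4 → ℝ≥0∞) (hf : Measurable f) (hg : Measurable g) :
    cv f g = ∫⁻ η, ∫⁻ η', ∫⁻ ζ, f η * f η' * (g (ζ - η) * g (ζ - η')) := by
  have hm : Measurable fun p : E4 × E4 × E4 =>
    f p.2.1 * f p.2.2 * (g (p.1 - p.2.1) * g (p.1 - p.2.2)) := by fun_prop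
  have e1 : cv f g = ∫⁻ ζ, ∫⁻ p : E4 × E4, f p.1 * f p.2 * (g (ζ - p.1) * g (ζ - p.2)) := by
    unfold cv
    congr 1; ext ζ
    rw [Measure.volume_eq_prod, lintegral_prod _ (by fun_prop), sq, ← lintegral_mul_const _ (by fun_prop)]
    congr 1; ext η
    rw [← lintegral_const_mul _ (by fun_prop)]
    congr 1; ext η'
    ring
  rw [e1, lintegral_lintegral_swap hm.aemeasurable, Measure.volume_eq_prod, lintegral_prod]
  exact (hm.comp measurable_swap).lintegral_prod_right'.aemeasurable

theorem cv_reflect (f g : E4 → ℝ≥0∞) (hf : Measurable f) (hg : Measurable g) :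
    cv f (fun x => g (-x)) = cv f g := by
  rw [cv_expand f g hf hg, cv_expand f _ hf (by fun_prop)]
  congr 1; ext η
  congr 1; ext η'
  rw [← lintegral_sub_left_eq_self _ (η + η')]
  congr 1; ext ζ
  rw [show -(η + η' - ζ - η) = ζ - η' by abel, show -(η + η' - ζ - η') = ζ - η by abel]
  ring

theorem split4_mp : MeasurePreserving (fun ζ : E4 => ((ζ 0, spacePart ζ) : ℝ × E3)) := by
  have h1 := EuclideanSpace.volume_preserving_symm_measurableEquiv_toLp (Fin 4)
  have h2 := volume_preserving_piFinSuccAbove (fun _ : Fin 4 => ℝ) 0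
  have h3 : MeasurePreserving (Prod.map id (MeasurableEquiv.toLp 2 (Fin 3 → ℝ)) :
      ℝ × (Fin 3 → ℝ) → ℝ × E3) :=
    (MeasurePreserving.id volume).prod
      (EuclideanSpace.volume_preserving_symm_measurableEquiv_toLp (Fin 3)).symm
  exact h3.comp (h2.comp h1)

theorem split4 (F : ℝ → E3 → ℝ≥0∞) (hF : Measurable fun p : ℝ × E3 => F p.1 p.2) :
    ∫⁻ ζ : E4, F (ζ 0) (spacePart ζ) = ∫⁻ ξ, ∫⁻ τ, F τ ξ := by
  rw [split4_mp.lintegral_comp hF, Measure.volume_eq_prod, lintegral_prod_symm _ hF.aemeasurable]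

theorem split3_mp : MeasurePreserving (fun ξ : E3 => ((ξ 0, ξ 1, ξ 2) : ℝ × ℝ × ℝ)) := by
  have h1 := EuclideanSpace.volume_preserving_symm_measurableEquiv_toLp (Fin 3)
  have h2 := volume_preserving_piFinSuccAbove (fun _ : Fin 3 => ℝ) 0
  have h3 : MeasurePreserving (Prod.map id (MeasurableEquiv.finTwoArrow) :
      ℝ × (Fin 2 → ℝ) → ℝ × (ℝ × ℝ)) :=
    (MeasurePreserving.id volume).prod (volume_preserving_finTwoArrow ℝ)
  exact h3.comp (h2.comp h1)

theorem split3 (F : ℝ → ℝ × ℝ → ℝ≥0∞) (hF : Measurable fun p : ℝ × ℝ × ℝ => F p.1 p.2) :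
    ∫⁻ ξ : E3, F (ξ 0) (ξ 1, ξ 2) = ∫⁻ z, ∫⁻ p, F z p := by
  rw [split3_mp.lintegral_comp hF, Measure.volume_eq_prod, lintegral_prod _ hF.aemeasurable]

theorem polar2 (f : ℝ → ℝ≥0∞) (hf : Measurable f) :
    ∫⁻ p : ℝ × ℝ, f (p.1 ^ 2 + p.2 ^ 2) =
      ENNReal.ofReal (2 * Real.pi) * ∫⁻ ρ in Set.Ioi (0 : ℝ), ENNReal.ofReal ρ * f (ρ ^ 2) := by
  rw [← lintegral_comp_polarCoord_symm, polarCoord_target, Measure.volume_eq_prod,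
    setLIntegral_prod]
  · simp only [polarCoord_symm_apply, smul_eq_mul]
    rw [← lintegral_const_mul _ (by fun_prop)]
    congr 1; ext ρ
    have : ∀ θ : ℝ, (ρ * Real.cos θ) ^ 2 + (ρ * Real.sin θ) ^ 2 = ρ ^ 2 := by
      intro θ
      have := Real.cos_sq_add_sin_sq θ
      linear_combination ρ ^ 2 * this
    simp only [this]
    rw [setLIntegral_const, Real.volume_Ioo]
    rw [mul_comm]
    congr 2; ring
  · simp only [polarCoord_symm_apply, smul_eq_mul]
    fun_prop

theorem oneD (z a : ℝ) (G : ℝ → ℝ≥0∞) :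
    ∫⁻ ρ in Set.Ioi (0 : ℝ), ENNReal.ofReal ρ *
      (ENNReal.ofReal ((√(z ^ 2 + ρ ^ 2))⁻¹ * (√((a - z) ^ 2 + ρ ^ 2))⁻¹) *
        G (√(z ^ 2 + ρ ^ 2) + √((a - z) ^ 2 + ρ ^ 2))) ≤
    ∫⁻ s in Set.Ioi |z|, ENNReal.ofReal s⁻¹ * G s := by
  set φ : ℝ → ℝ := fun ρ => √(z ^ 2 + ρ ^ 2) + √((a - z) ^ 2 + ρ ^ 2) with hφ
  set φ' : ℝ → ℝ := fun ρ => ρ / √(z ^ 2 + ρ ^ 2) + ρ / √((a - z) ^ 2 + ρ ^ 2) with hφ'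
  have hd : ∀ ρ ∈ Set.Ioi (0 : ℝ), HasDerivWithinAt φ (φ' ρ) (Set.Ioi 0) ρ := by
    intro ρ hρ
    have hρ : 0 < ρ := hρ
    have aux : ∀ c : ℝ, HasDerivAt (fun ρ : ℝ => √(c ^ 2 + ρ ^ 2)) (ρ / √(c ^ 2 + ρ ^ 2)) ρ := by
      intro c
      have h1 : HasDerivAt (fun ρ : ℝ => c ^ 2 + ρ ^ 2) (2 * ρ) ρ := by
        simpa using ((hasDerivAt_pow 2 ρ).const_add (c ^ 2))
      have := h1.sqrt (by positivity)
      convert this using 1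
      field_simp
    exact ((aux z).add (aux (a - z))).hasDerivWithinAt
  have hinj : Set.InjOn φ (Set.Ioi 0) := by
    apply StrictMonoOn.injOn
    intro x hx y hy hxy
    have hx : 0 < x := hx
    have : x ^ 2 < y ^ 2 := by gcongr
    simp only [hφ]
    apply add_lt_add <;> apply Real.sqrt_lt_sqrt <;> first | positivity | linarith
  have key := lintegral_image_eq_lintegral_abs_deriv_mul measurableSet_Ioi hd hinj
    (fun s => ENNReal.ofReal s⁻¹ * G s)
  have himg : φ '' Set.Ioi 0 ⊆ Set.Ioi |z| := by
    rintro _ ⟨ρ, hρ, rfl⟩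
    have hρ : 0 < ρ := hρ
    have h1 : |z| < √(z ^ 2 + ρ ^ 2) := by
      rw [← Real.sqrt_sq_eq_abs]
      apply Real.sqrt_lt_sqrt (by positivity)
      have := pow_pos hρ 2
      linarith
    have h2 := Real.sqrt_nonneg ((a - z) ^ 2 + ρ ^ 2)
    simp only [hφ, Set.mem_Ioi]
    linarith
  refine le_trans (le_of_eq ?_) (lintegral_mono_set himg)
  rw [key]
  refine setLIntegral_congr_fun measurableSet_Ioi ?_
  intro ρ hρ
  have hρ : 0 < ρ := hρ
  have p1 : 0 < √(z ^ 2 + ρ ^ 2) := by positivity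
  have p2 : 0 < √((a - z) ^ 2 + ρ ^ 2) := by positivity
  simp only [← mul_assoc]
  congr 1
  rw [← ENNReal.ofReal_mul hρ.le, ← ENNReal.ofReal_mul (abs_nonneg _)]
  congr 1
  rw [abs_of_pos (by positivity)]
  simp only [hφ, hφ']
  field_simp
  ring

theorem fubini_cone (G : ℝ → ℝ≥0∞) (hG : Measurable G) :
    ∫⁻ z : ℝ, ∫⁻ s in Set.Ioi |z|, ENNReal.ofReal s⁻¹ * G s ≤ 2 * ∫⁻ s, G s := by
  have hm : Measurable fun p : ℝ × ℝ =>
      ({q : ℝ × ℝ | |q.1| < q.2}.indicator (fun q => ENNReal.ofReal q.2⁻¹ * G q.2)) p := by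
    apply Measurable.indicator (by fun_prop)
    exact measurableSet_lt (by fun_prop) (by fun_prop)
  calc ∫⁻ z : ℝ, ∫⁻ s in Set.Ioi |z|, ENNReal.ofReal s⁻¹ * G s
      = ∫⁻ z : ℝ, ∫⁻ s, ({q : ℝ × ℝ | |q.1| < q.2}.indicator
          (fun q => ENNReal.ofReal q.2⁻¹ * G q.2)) (z, s) := by
        congr 1; ext z
        rw [← lintegral_indicator measurableSet_Ioi]
        rfl
    _ = ∫⁻ s : ℝ, ∫⁻ z, ({q : ℝ × ℝ | |q.1| < q.2}.indicator
          (fun q => ENNReal.ofReal q.2⁻¹ * G q.2)) (z, s) :=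
        lintegral_lintegral_swap hm.aemeasurable
    _ ≤ ∫⁻ s : ℝ, 2 * G s := by
        refine lintegral_mono fun s => ?_
        calc ∫⁻ z, ({q : ℝ × ℝ | |q.1| < q.2}.indicator
              (fun q => ENNReal.ofReal q.2⁻¹ * G q.2)) (z, s)
            = ∫⁻ z, (Set.Ioo (-s) s).indicator (fun _ => ENNReal.ofReal s⁻¹ * G s) z := by
              congr 1; ext z
              simp [Set.indicator, abs_lt]
          _ = ENNReal.ofReal s⁻¹ * G s * ENNReal.ofReal (s - -s) := by
              rw [lintegral_indicator_const measurableSet_Ioo, Real.volume_Ioo]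
          _ ≤ 2 * G s := by
              rcases le_or_gt s 0 with h | h
              · rw [ENNReal.ofReal_of_nonpos (p := s - -s) (by linarith)]; simp
              · rw [mul_right_comm, ← ENNReal.ofReal_mul (by positivity)]
                rw [show s⁻¹ * (s - -s) = 2 by field_simp; ring]
                simp
    _ = 2 * ∫⁻ s, G s := lintegral_const_mul _ hG

theorem norm3 (ξ : E3) : ‖ξ‖ = √(ξ 0 ^ 2 + (ξ 1 ^ 2 + ξ 2 ^ 2)) := by
  rw [EuclideanSpace.norm_eq]
  simp [Fin.sum_univ_three, add_assoc]

theorem ellipse_axis (a : ℝ) (G : ℝ → ℝ≥0∞) (hG : Measurable G) :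
    ∫⁻ η : E3, ENNReal.ofReal (‖η‖⁻¹ * ‖EuclideanSpace.single 0 a - η‖⁻¹) *
      G (‖η‖ + ‖EuclideanSpace.single 0 a - η‖) ≤
    ENNReal.ofReal (4 * Real.pi) * ∫⁻ s, G s := by
  have e : ∀ η : E3, ‖EuclideanSpace.single 0 a - η‖ =
      √((a - η 0) ^ 2 + (η 1 ^ 2 + η 2 ^ 2)) := by
    intro η
    rw [norm3]; simp
  simp only [e, norm3]
  rw [split3 (fun z p => ENNReal.ofReal ((√(z ^ 2 + (p.1 ^ 2 + p.2 ^ 2)))⁻¹ *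
    (√((a - z) ^ 2 + (p.1 ^ 2 + p.2 ^ 2)))⁻¹) *
      G (√(z ^ 2 + (p.1 ^ 2 + p.2 ^ 2)) + √((a - z) ^ 2 + (p.1 ^ 2 + p.2 ^ 2)))) (by fun_prop)]
  calc _ ≤ ∫⁻ z : ℝ, ENNReal.ofReal (2 * Real.pi) *
        ∫⁻ s in Set.Ioi |z|, ENNReal.ofReal s⁻¹ * G s := by
        refine lintegral_mono fun z => ?_
        rw [polar2 (fun w => ENNReal.ofReal ((√(z ^ 2 + w))⁻¹ *
          (√((a - z) ^ 2 + w))⁻¹) * G (√(z ^ 2 + w) + √((a - z) ^ 2 + w))) (by fun_prop)]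
        exact mul_le_mul' le_rfl (oneD z a G)
    _ = ENNReal.ofReal (2 * Real.pi) * ∫⁻ z : ℝ,
        ∫⁻ s in Set.Ioi |z|, ENNReal.ofReal s⁻¹ * G s :=
        lintegral_const_mul' _ _ (by finiteness)
    _ ≤ ENNReal.ofReal (2 * Real.pi) * (2 * ∫⁻ s, G s) := by
        gcongr
        exact fubini_cone G hG
    _ = _ := by
        rw [← mul_assoc, ← ENNReal.ofReal_ofNat 2, ← ENNReal.ofReal_mul (by positivity)]
        congr 2; ring

theorem ellipse (ξ : E3) (G : ℝ → ℝ≥0∞) (hG : Measurable G) :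
    ∫⁻ η : E3, ENNReal.ofReal (‖η‖⁻¹ * ‖ξ - η‖⁻¹) * G (‖η‖ + ‖ξ - η‖) ≤
    ENNReal.ofReal (4 * Real.pi) * ∫⁻ s, G s := by
  obtain ⟨R, hR⟩ : ∃ R : E3 ≃ₗᵢ[ℝ] E3, R ξ = EuclideanSpace.single 0 ‖ξ‖ := by
    refine ⟨Submodule.reflection _, Submodule.reflection_sub ?_⟩
    simp
  refine le_trans (le_of_eq ?_) (ellipse_axis ‖ξ‖ G hG)
  conv_rhs => rw [← R.measurePreserving.lintegral_comp (by fun_prop)]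
  congr 1; ext η
  rw [← hR, ← map_sub, R.norm_map, R.norm_map]

theorem ball_two (R : ℝ) :
    ∫⁻ η : E3, ENNReal.ofReal (‖η‖⁻¹ ^ 2) * (Set.Icc 0 R).indicator 1 ‖η‖ ≤
      ENNReal.ofReal (8 * Real.pi * R) := by
  have h := ellipse 0 ((Set.Icc 0 (2 * R)).indicator 1)
    (measurable_one.indicator measurableSet_Icc)
  rw [lintegral_indicator_one measurableSet_Icc, Real.volume_Icc,
    ← ENNReal.ofReal_mul (by positivity)] at h
  refine le_trans (le_of_eq ?_) (h.trans_eq ?_)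
  · congr 1; ext η
    simp only [zero_sub, norm_neg, Set.indicator, Set.mem_Icc, Pi.one_apply]
    rw [sq]
    congr 2
    apply propext
    constructor <;> rintro ⟨h1, h2⟩ <;> constructor <;> linarith
  · congr 1; ring

theorem ball_one (R : ℝ) (hR : 0 ≤ R) :
    ∫⁻ η : E3, ENNReal.ofReal (‖η‖⁻¹) * (Set.Icc 0 R).indicator 1 ‖η‖ ≤
      ENNReal.ofReal (8 * Real.pi * R ^ 2) := by
  calc _ ≤ ∫⁻ η : E3, ENNReal.ofReal R *
        (ENNReal.ofReal (‖η‖⁻¹ ^ 2) * (Set.Icc 0 R).indicator 1 ‖η‖) := by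
        refine lintegral_mono fun η => ?_
        by_cases h : ‖η‖ ∈ Set.Icc 0 R
        · simp only [Set.indicator_of_mem h, Pi.one_apply, mul_one]
          rw [← ENNReal.ofReal_mul hR]
          apply ENNReal.ofReal_le_ofReal
          rcases eq_or_ne ‖η‖ 0 with h0 | h0
          · simp [h0]
          · have : 0 < ‖η‖ := lt_of_le_of_ne (norm_nonneg _) h0.symm
            rw [sq]
            calc ‖η‖⁻¹ = ‖η‖ * (‖η‖⁻¹ * ‖η‖⁻¹) := by field_simp
              _ ≤ _ := by gcongr; exact h.2
        · simp [Set.indicator_of_notMem h]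
    _ = ENNReal.ofReal R * ∫⁻ η : E3,
        (ENNReal.ofReal (‖η‖⁻¹ ^ 2) * (Set.Icc 0 R).indicator 1 ‖η‖) :=
        lintegral_const_mul' _ _ (by finiteness)
    _ ≤ ENNReal.ofReal R * ENNReal.ofReal (8 * Real.pi * R) := by
        gcongr
        exact ball_two R
    _ = _ := by
        rw [← ENNReal.ofReal_mul hR]; congr 1; ring

theorem lorentz (r : ℝ) (hr : 0 < r) :
    ∫⁻ τ : ℝ, ENNReal.ofReal ((τ ^ 2 + r ^ 2)⁻¹) ≤ ENNReal.ofReal (Real.pi * r⁻¹) := by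
  have e : ∀ τ : ℝ, (τ ^ 2 + r ^ 2)⁻¹ = r⁻¹ ^ 2 * (1 + (r⁻¹ * τ) ^ 2)⁻¹ := by
    intro τ
    field_simp
    ring
  have hi : Integrable fun τ : ℝ => (1 + (r⁻¹ * τ) ^ 2)⁻¹ :=
    integrable_inv_one_add_sq.comp_mul_left' (by positivity)
  simp only [e]
  rw [← ofReal_integral_eq_lintegral_ofReal (hi.const_mul _)
    (Filter.Eventually.of_forall fun τ => by positivity)]
  apply ENNReal.ofReal_le_ofReal
  rw [integral_const_mul, Measure.integral_comp_mul_left (fun x => (1 + x ^ 2)⁻¹),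
    integral_univ_inv_one_add_sq, abs_of_pos (by positivity)]
  simp only [inv_inv, smul_eq_mul]
  apply le_of_eq
  field_simp

/-- the basic modulation integral -/
def cmod (b : ℝ) : ℝ≥0∞ := ∫⁻ t : ℝ, ENNReal.ofReal ((1 + t ^ 2) ^ (-b))

theorem cmod_lt (b : ℝ) (hb : 1 / 2 < b) : cmod b < ∞ := by
  have h := integrable_rpow_neg_one_add_norm_sq (E := ℝ) (μ := volume) (r := 2 * b)
    (by simp; linarith)
  have := h.lintegral_lt_top
  unfold cmod
  rw [show -(2 * b) / 2 = -b by ring] at this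
  simpa using this

/-- the basic spatial integral -/
def cspace (b : ℝ) : ℝ≥0∞ := ∫⁻ ξ : E3, ENNReal.ofReal ((1 + ‖ξ‖ ^ 2) ^ (-(1 + b)))

theorem cspace_lt (b : ℝ) (hb : 1 / 2 < b) : cspace b < ∞ := by
  have h := integrable_rpow_neg_one_add_norm_sq (E := E3) (μ := volume) (r := 2 + 2 * b)
    (by simp; linarith)
  have := h.lintegral_lt_top
  unfold cspace
  rwa [show -(2 + 2 * b) / 2 = -(1 + b) by ring] at this

theorem mod_int (b : ℝ) (r : ℝ) :
    ∫⁻ τ : ℝ, ENNReal.ofReal ((1 + (|τ| - r) ^ 2) ^ (-b)) ≤ 2 * cmod b := by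
  calc _ ≤ ∫⁻ τ : ℝ, (ENNReal.ofReal ((1 + (τ - r) ^ 2) ^ (-b)) +
        ENNReal.ofReal ((1 + (τ + r) ^ 2) ^ (-b))) := by
        refine lintegral_mono fun τ => ?_
        rcases abs_cases τ with ⟨h, _⟩ | ⟨h, _⟩
        · simp only [h]; exact le_self_add
        · simp only [h]
          rw [show (-τ - r) ^ 2 = (τ + r) ^ 2 by ring]
          exact le_add_self
    _ = 2 * cmod b := by
        rw [lintegral_add_left (by fun_prop),
          lintegral_sub_right_eq_self (fun t : ℝ => ENNReal.ofReal ((1 + t ^ 2) ^ (-b))),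
          lintegral_add_right_eq_self (fun t : ℝ => ENNReal.ofReal ((1 + t ^ 2) ^ (-b))),
          cmod, two_mul]

theorem two_mod (b : ℝ) (hb : 1 / 2 < b) (x y : ℝ) :
    (1 + x ^ 2) ^ (-b) * (1 + y ^ 2) ^ (-b) ≤
      (1 + ((x + y) / 2) ^ 2) ^ (-b) * ((1 + x ^ 2) ^ (-b) + (1 + y ^ 2) ^ (-b)) := by
  have px : 0 < (1 + x ^ 2) ^ (-b) := by positivity
  have py : 0 < (1 + y ^ 2) ^ (-b) := by positivity
  have ps : 0 < (1 + ((x + y) / 2) ^ 2) ^ (-b) := by positivity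
  rcases le_total (x ^ 2) (y ^ 2) with h | h
  · have : (1 + y ^ 2) ^ (-b) ≤ (1 + ((x + y) / 2) ^ 2) ^ (-b) := by
      apply Real.rpow_le_rpow_of_nonpos (by positivity) _ (by linarith)
      nlinarith [sq_nonneg (x - y)]
    nlinarith
  · have : (1 + x ^ 2) ^ (-b) ≤ (1 + ((x + y) / 2) ^ 2) ^ (-b) := by
      apply Real.rpow_le_rpow_of_nonpos (by positivity) _ (by linarith)
      nlinarith [sq_nonneg (x - y)]
    nlinarith

theorem two_mod_int (b : ℝ) (hb : 1 / 2 < b) (r s t : ℝ) :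
    ∫⁻ τ : ℝ, ENNReal.ofReal ((1 + (τ - r) ^ 2) ^ (-b) * (1 + (t - τ - s) ^ 2) ^ (-b)) ≤
      ENNReal.ofReal ((1 + ((t - (r + s)) / 2) ^ 2) ^ (-b)) * (2 * cmod b) := by
  calc _ ≤ ∫⁻ τ : ℝ, ENNReal.ofReal ((1 + ((t - (r + s)) / 2) ^ 2) ^ (-b)) *
        (ENNReal.ofReal ((1 + (τ - r) ^ 2) ^ (-b)) +
        ENNReal.ofReal ((1 + (t - s - τ) ^ 2) ^ (-b))) := by
        refine lintegral_mono fun τ => ?_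
        simp only
        rw [← ENNReal.ofReal_add (by positivity) (by positivity),
          ← ENNReal.ofReal_mul (by positivity)]
        apply ENNReal.ofReal_le_ofReal
        have := two_mod b hb (τ - r) (t - τ - s)
        rw [show (τ - r + (t - τ - s)) = t - (r + s) by ring] at this
        rwa [show t - s - τ = t - τ - s by ring]
    _ = _ := by
        rw [lintegral_const_mul' _ _ (by finiteness), lintegral_add_left (by fun_prop),
          lintegral_sub_right_eq_self (fun t : ℝ => ENNReal.ofReal ((1 + t ^ 2) ^ (-b))),
          lintegral_sub_left_eq_self (fun t : ℝ => ENNReal.ofReal ((1 + t ^ 2) ^ (-b))),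
          cmod, two_mul]

theorem half_mod_int (b : ℝ) (t : ℝ) :
    ∫⁻ s : ℝ, ENNReal.ofReal ((1 + ((t - s) / 2) ^ 2) ^ (-b)) = 2 * cmod b := by
  rw [lintegral_sub_left_eq_self (fun t : ℝ => ENNReal.ofReal ((1 + (t / 2) ^ 2) ^ (-b)))]
  have hmap : Measure.map (fun x : ℝ => 2⁻¹ * x) volume = (2 : ℝ≥0∞) • (volume : Measure ℝ) := by
    have := Real.map_volume_mul_left (a := 2⁻¹) (by norm_num)
    rw [this]; simp
  have h2 : ∫⁻ s : ℝ, ENNReal.ofReal ((1 + (s / 2) ^ 2) ^ (-b)) =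
      ∫⁻ s, ENNReal.ofReal ((1 + s ^ 2) ^ (-b)) ∂(Measure.map (fun x : ℝ => 2⁻¹ * x) volume) := by
    rw [lintegral_map (by fun_prop) (by fun_prop)]
    congr 1; ext s
    congr 4; ring
  rw [h2, hmap, lintegral_smul_measure, cmod, smul_eq_mul]

@[fun_prop]
theorem measurable_spacePart : Measurable spacePart := by
  exact measurable_snd.comp split4_mp.measurable

theorem spacePart_sub (x y : E4) : spacePart (x - y) = spacePart x - spacePart y := by
  ext i; simp [spacePart]

theorem spacePart_add (x y : E4) : spacePart (x + y) = spacePart x + spacePart y := by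
  ext i; simp [spacePart]

theorem spacePart_neg (x : E4) : spacePart (-x) = -spacePart x := by
  ext i; simp [spacePart]

theorem norm_sq4 (ζ : E4) : ‖ζ‖ ^ 2 = ζ 0 ^ 2 + ‖spacePart ζ‖ ^ 2 := by
  rw [EuclideanSpace.norm_sq_eq, EuclideanSpace.norm_sq_eq, Fin.sum_univ_succ]
  simp [spacePart]

/-- `1 + |ξ|²` -/
def wA (ζ : E4) : ℝ := 1 + ‖spacePart ζ‖ ^ 2

/-- `1 + (|τ| - |ξ|)²` -/
def wB (ζ : E4) : ℝ := 1 + (|ζ 0| - ‖spacePart ζ‖) ^ 2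

/-- `1 + (τ - |ξ|)²` -/
def wP (ζ : E4) : ℝ := 1 + (ζ 0 - ‖spacePart ζ‖) ^ 2

theorem one_le_wA (ζ : E4) : 1 ≤ wA ζ := by unfold wA; nlinarith [sq_nonneg ‖spacePart ζ‖]
theorem one_le_wB (ζ : E4) : 1 ≤ wB ζ := by
  unfold wB; nlinarith [sq_nonneg (|ζ 0| - ‖spacePart ζ‖)]
theorem one_le_wP (ζ : E4) : 1 ≤ wP ζ := by
  unfold wP; nlinarith [sq_nonneg (ζ 0 - ‖spacePart ζ‖)]

@[fun_prop]
theorem measurable_wA : Measurable wA := by unfold wA; fun_prop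
@[fun_prop]
theorem measurable_wB : Measurable wB := by unfold wB; fun_prop
@[fun_prop]
theorem measurable_wP : Measurable wP := by unfold wP; fun_prop

/-- near-near factor -/
def hN (b : ℝ) (ζ : E4) : ℝ := wA ζ ^ (-(1 / 4) : ℝ) * wB ζ ^ (-b / 2)

/-- one-sided near-near factor -/
def hP (b : ℝ) (ζ : E4) : ℝ := wA ζ ^ (-(1 / 4) : ℝ) * wP ζ ^ (-b / 2)

/-- kernel of type A -/
def kA (b : ℝ) (x y : E4) : ℝ := wA y ^ (-(1 + b) / 2) * wB x ^ (-b / 2)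

open Classical in
/-- kernel of type B -/
def kB (x y : E4) : ℝ :=
  if ‖spacePart y‖ ≤ ‖spacePart x‖ then ‖x + y‖⁻¹ * wA y ^ (-(1 / 2) : ℝ) else 0

open Classical in
/-- kernel of type B, first part -/
def kB1 (x y : E4) : ℝ :=
  if ‖spacePart (x + y)‖ ≤ ‖spacePart y‖ then ‖x + y‖⁻¹ * wA y ^ (-(1 / 2) : ℝ) else 0

open Classical in
/-- kernel of type B, second part -/
def kB2 (x y : E4) : ℝ :=
  if ‖spacePart y‖ ≤ ‖spacePart x‖ ∧ ‖spacePart x‖ ≤ 2 * ‖spacePart (x + y)‖ then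
    ‖x + y‖⁻¹ * wA y ^ (-(1 / 2) : ℝ) else 0

@[fun_prop]
theorem measurable_hN (b : ℝ) : Measurable (hN b) := by unfold hN; fun_prop
@[fun_prop]
theorem measurable_hP (b : ℝ) : Measurable (hP b) := by unfold hP; fun_prop
theorem measurable_kA (b : ℝ) : Measurable fun p : E4 × E4 => kA b p.1 p.2 := by
  unfold kA; fun_prop
theorem measurable_kB : Measurable fun p : E4 × E4 => kB p.1 p.2 := by
  unfold kB
  exact Measurable.ite (measurableSet_le (by fun_prop) (by fun_prop)) (by fun_prop) (by fun_prop)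
theorem measurable_kB1 : Measurable fun p : E4 × E4 => kB1 p.1 p.2 := by
  unfold kB1
  exact Measurable.ite (measurableSet_le (by fun_prop) (by fun_prop)) (by fun_prop) (by fun_prop)
theorem measurable_kB2 : Measurable fun p : E4 × E4 => kB2 p.1 p.2 := by
  unfold kB2
  have h1 : MeasurableSet {p : E4 × E4 | ‖spacePart p.2‖ ≤ ‖spacePart p.1‖} :=
    measurableSet_le (by fun_prop) (by fun_prop)
  have h2 : MeasurableSet {p : E4 × E4 | ‖spacePart p.1‖ ≤ 2 * ‖spacePart (p.1 + p.2)‖} :=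
    measurableSet_le (by fun_prop) (by fun_prop)
  exact Measurable.ite (h1.inter h2) (by fun_prop) (by fun_prop)

theorem ofReal_rpow_sq (x y : ℝ) (hx : 0 ≤ x) :
    ENNReal.ofReal (x ^ y) ^ 2 = ENNReal.ofReal (x ^ (2 * y)) := by
  rw [← ENNReal.ofReal_pow (by positivity), ← Real.rpow_natCast, ← Real.rpow_mul hx]
  congr 2; push_cast; ring

theorem kA_int (b : ℝ) (ζ : E4) :
    ∫⁻ η, ENNReal.ofReal (kA b η (ζ - η)) ^ 2 ≤ 2 * cmod b * cspace b := by
  have e : ∀ η, ENNReal.ofReal (kA b η (ζ - η)) ^ 2 =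
      ENNReal.ofReal ((1 + ‖spacePart ζ - spacePart η‖ ^ 2) ^ (-(1 + b))) *
        ENNReal.ofReal ((1 + (|η 0| - ‖spacePart η‖) ^ 2) ^ (-b)) := by
    intro η
    have hA := one_le_wA (ζ - η)
    have hB := one_le_wB η
    unfold kA
    rw [ENNReal.ofReal_mul (by positivity), mul_pow, ofReal_rpow_sq _ _ (by positivity),
      ofReal_rpow_sq _ _ (by positivity), wA, wB, spacePart_sub]
    congr 3
    · ring_nf
    · ring_nf
  simp only [e]
  rw [split4 (fun τ ξ => ENNReal.ofReal ((1 + ‖spacePart ζ - ξ‖ ^ 2) ^ (-(1 + b))) *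
        ENNReal.ofReal ((1 + (|τ| - ‖ξ‖) ^ 2) ^ (-b))) (by fun_prop)]
  calc _ ≤ ∫⁻ ξ : E3, ENNReal.ofReal ((1 + ‖spacePart ζ - ξ‖ ^ 2) ^ (-(1 + b))) *
        (2 * cmod b) := by
        refine lintegral_mono fun ξ => ?_
        simp only
        rw [lintegral_const_mul' _ _ (by finiteness)]
        gcongr
        exact mod_int b _
    _ = _ := by
        rw [lintegral_mul_const _ (by fun_prop), lintegral_sub_left_eq_self
          (fun x : E3 => ENNReal.ofReal ((1 + ‖x‖ ^ 2) ^ (-(1 + b)))), ← cspace, mul_comm]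

theorem rpow_half_le_inv (x : ℝ) (hx : 0 < x) : (1 + x ^ 2) ^ (-(1 / 2) : ℝ) ≤ x⁻¹ := by
  rw [Real.rpow_neg (by positivity), ← Real.sqrt_eq_rpow]
  gcongr
  exact Real.le_sqrt_of_sq_le (by linarith)

theorem hP_int (b : ℝ) (hb : 1 / 2 < b) (ζ : E4) :
    ∫⁻ η, (ENNReal.ofReal (hP b η) * ENNReal.ofReal (hP b (ζ - η))) ^ 2 ≤
      ENNReal.ofReal (4 * Real.pi) * (2 * cmod b) * (2 * cmod b) := by
  have e : ∀ η, (ENNReal.ofReal (hP b η) * ENNReal.ofReal (hP b (ζ - η))) ^ 2 =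
      ENNReal.ofReal ((1 + ‖spacePart η‖ ^ 2) ^ (-(1 / 2) : ℝ) *
        (1 + ‖spacePart ζ - spacePart η‖ ^ 2) ^ (-(1 / 2) : ℝ)) *
        ENNReal.ofReal ((1 + (η 0 - ‖spacePart η‖) ^ 2) ^ (-b) *
          (1 + (ζ 0 - η 0 - ‖spacePart ζ - spacePart η‖) ^ 2) ^ (-b)) := by
    intro η
    have hA := one_le_wA (ζ - η)
    have hB := one_le_wP (ζ - η)
    have hA' := one_le_wA η
    have hB' := one_le_wP η
    unfold hP
    rw [ENNReal.ofReal_mul (by positivity), ENNReal.ofReal_mul (by positivity), mul_pow, mul_pow,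
      mul_pow, ofReal_rpow_sq _ _ (by positivity),
      ofReal_rpow_sq _ _ (by positivity), ofReal_rpow_sq _ _ (by positivity),
      ofReal_rpow_sq _ _ (by positivity), wA, wA, wP, wP, spacePart_sub,
      ENNReal.ofReal_mul (by positivity), ENNReal.ofReal_mul (by positivity),
      PiLp.sub_apply]
    rw [show 2 * (-(1 / 4) : ℝ) = -(1 / 2) by norm_num, show 2 * (-b / 2) = -b by ring]
    ring
  simp only [e]
  rw [split4 (fun τ ξ => ENNReal.ofReal ((1 + ‖ξ‖ ^ 2) ^ (-(1 / 2) : ℝ) *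
        (1 + ‖spacePart ζ - ξ‖ ^ 2) ^ (-(1 / 2) : ℝ)) *
        ENNReal.ofReal ((1 + (τ - ‖ξ‖) ^ 2) ^ (-b) *
          (1 + (ζ 0 - τ - ‖spacePart ζ - ξ‖) ^ 2) ^ (-b))) (by fun_prop)]
  have hG : Measurable fun s : ℝ => ENNReal.ofReal ((1 + ((ζ 0 - s) / 2) ^ 2) ^ (-b)) := by
    fun_prop
  have hell := ellipse (spacePart ζ) _ hG
  rw [half_mod_int] at hell
  calc _ ≤ ∫⁻ ξ : E3, (ENNReal.ofReal (‖ξ‖⁻¹ * ‖spacePart ζ - ξ‖⁻¹) *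
        ENNReal.ofReal ((1 + ((ζ 0 - (‖ξ‖ + ‖spacePart ζ - ξ‖)) / 2) ^ 2) ^ (-b))) *
        (2 * cmod b) := by
        apply lintegral_mono_ae
        have h1 : ∀ᵐ ξ : E3, ξ ≠ 0 := by
          simp [ae_iff]
        have h2 : ∀ᵐ ξ : E3, ξ ≠ spacePart ζ := by
          simp [ae_iff]
        filter_upwards [h1, h2] with ξ hξ hξ'
        rw [lintegral_const_mul' _ _ (by finiteness), mul_assoc]
        gcongr
        · exact rpow_half_le_inv _ (norm_pos_iff.2 hξ)
        · exact rpow_half_le_inv _ (norm_pos_iff.2 (sub_ne_zero.2 hξ'.symm))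
        · exact two_mod_int b hb _ _ _
    _ ≤ _ := by
        rw [lintegral_mul_const _ (by fun_prop)]
        gcongr

theorem wA_half_sq (y : E4) : (wA y ^ (-(1 / 2) : ℝ)) ^ 2 = (wA y)⁻¹ := by
  have := one_le_wA y
  rw [← Real.rpow_natCast, ← Real.rpow_mul (by positivity)]
  norm_num
  rw [Real.rpow_neg_one]

theorem kB1_int (y : E4) :
    ∫⁻ x, ENNReal.ofReal (kB1 x y) ^ 2 ≤ ENNReal.ofReal (8 * Real.pi ^ 2) := by
  have hA := one_le_wA y
  set R := ‖spacePart y‖ with hR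
  have e : ∀ x, ENNReal.ofReal (kB1 x y) ^ 2 =
      (fun ζ : E4 => ENNReal.ofReal (wA y)⁻¹ * ((Set.Icc 0 R).indicator 1 ‖spacePart ζ‖ *
        ENNReal.ofReal (ζ 0 ^ 2 + ‖spacePart ζ‖ ^ 2)⁻¹)) (x + y) := by
    intro x
    simp only [kB1, ← norm_sq4]
    by_cases h : ‖spacePart (x + y)‖ ≤ R
    · have h' : ‖spacePart (x + y)‖ ∈ Set.Icc 0 R := ⟨norm_nonneg _, h⟩
      rw [if_pos h, Set.indicator_of_mem h', Pi.one_apply, one_mul,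
        ← ENNReal.ofReal_mul (by positivity), ← ENNReal.ofReal_pow (by positivity), mul_pow,
        wA_half_sq, inv_pow, mul_comm]
    · have h' : ‖spacePart (x + y)‖ ∉ Set.Icc 0 R := fun hh => h hh.2
      rw [if_neg h, Set.indicator_of_notMem h']
      simp
  simp only [e]
  rw [lintegral_add_right_eq_self (fun ζ : E4 => ENNReal.ofReal (wA y)⁻¹ *
    ((Set.Icc 0 R).indicator 1 ‖spacePart ζ‖ *
        ENNReal.ofReal (ζ 0 ^ 2 + ‖spacePart ζ‖ ^ 2)⁻¹)) y,
    lintegral_const_mul' _ _ (by finiteness)]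
  have hind : Measurable ((Set.Icc 0 R).indicator (1 : ℝ → ℝ≥0∞)) :=
    measurable_one.indicator measurableSet_Icc
  rw [split4 (fun τ ξ => (Set.Icc 0 R).indicator 1 ‖ξ‖ *
        ENNReal.ofReal (τ ^ 2 + ‖ξ‖ ^ 2)⁻¹) (by fun_prop)]
  calc _ ≤ ENNReal.ofReal (wA y)⁻¹ * ∫⁻ ξ : E3, ENNReal.ofReal Real.pi *
        (ENNReal.ofReal (‖ξ‖⁻¹) * (Set.Icc 0 R).indicator 1 ‖ξ‖) := by
        refine mul_le_mul' le_rfl ?_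
        apply lintegral_mono_ae
        have h1 : ∀ᵐ ξ : E3, ξ ≠ 0 := by
          simp [ae_iff]
        filter_upwards [h1] with ξ hξ
        rw [lintegral_const_mul _ (by fun_prop), ← mul_assoc, mul_comm]
        refine mul_le_mul' ?_ le_rfl
        rw [← ENNReal.ofReal_mul (by positivity)]
        exact lorentz _ (norm_pos_iff.2 hξ)
    _ ≤ ENNReal.ofReal (wA y)⁻¹ * (ENNReal.ofReal Real.pi * ENNReal.ofReal (8 * Real.pi * R ^ 2)) := by
        rw [lintegral_const_mul _ (by fun_prop)]
        refine mul_le_mul' le_rfl (mul_le_mul' le_rfl ?_)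
        exact ball_one R (norm_nonneg _)
    _ ≤ _ := by
        rw [← ENNReal.ofReal_mul (by positivity), ← ENNReal.ofReal_mul (by positivity)]
        apply ENNReal.ofReal_le_ofReal
        have : R ^ 2 ≤ wA y := by simp [wA, hR]
        calc (wA y)⁻¹ * (Real.pi * (8 * Real.pi * R ^ 2))
            ≤ (wA y)⁻¹ * (Real.pi * (8 * Real.pi * wA y)) := by gcongr
          _ = _ := by field_simp

theorem ae_spacePart : ∀ᵐ y : E4, spacePart y ≠ 0 := by
  rw [ae_iff, ← lintegral_indicator_one]
  · have h := split4 (fun _ ξ => ({0} : Set E3).indicator 1 ξ)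
      ((measurable_one.indicator (measurableSet_singleton 0)).comp measurable_snd)
    calc _ = _ := ?_
      _ = _ := h
      _ = 0 := ?_
    · congr 1; ext y
      simp [Set.indicator]
    · rw [lintegral_eq_zero_iff']
      · have h1 : ∀ᵐ ξ : E3, ξ ≠ 0 := by simp [ae_iff]
        filter_upwards [h1] with ξ hξ
        simp [hξ]
      · simp only [lintegral_const]
        exact ((measurable_one.indicator (measurableSet_singleton 0)).mul_const _).aemeasurable
  · have : {a : E4 | ¬spacePart a ≠ 0} = spacePart ⁻¹' {0} := by ext; simp
    rw [this]
    exact measurable_spacePart (measurableSet_singleton 0)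

theorem kB2_int (x : E4) :
    ∫⁻ y, ENNReal.ofReal (kB2 x y) ^ 2 ≤ ENNReal.ofReal (32 * Real.pi ^ 2) := by
  set R := ‖spacePart x‖ with hR
  have hind : Measurable ((Set.Icc 0 R).indicator (1 : ℝ → ℝ≥0∞)) :=
    measurable_one.indicator measurableSet_Icc
  rcases eq_or_ne R 0 with h0 | h0
  · have hz : ∀ᵐ y : E4, ENNReal.ofReal (kB2 x y) ^ 2 = 0 := by
      filter_upwards [ae_spacePart] with y hy
      have : ¬ ‖spacePart y‖ ≤ R := by
        rw [h0]; simpa using hy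
      simp [kB2, ← hR, this]
    rw [lintegral_congr_ae hz]; simp
  have hRp : 0 < R := lt_of_le_of_ne (norm_nonneg _) h0.symm
  calc _ ≤ ∫⁻ y : E4, (ENNReal.ofReal (‖spacePart y‖⁻¹ ^ 2) *
        (Set.Icc 0 R).indicator 1 ‖spacePart y‖) * ENNReal.ofReal (4 * ((x 0 + y 0) ^ 2 + R ^ 2)⁻¹) := by
        apply lintegral_mono_ae
        filter_upwards [ae_spacePart] with y hy
        have hA := one_le_wA y
        unfold kB2
        split_ifs with h
        · have h' : ‖spacePart y‖ ∈ Set.Icc 0 R := ⟨norm_nonneg _, h.1⟩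
          rw [Set.indicator_of_mem h', Pi.one_apply, mul_one, ← ENNReal.ofReal_pow (by positivity),
            ← ENNReal.ofReal_mul (by positivity), mul_pow, mul_comm, wA_half_sq, inv_pow, inv_pow]
          apply ENNReal.ofReal_le_ofReal
          have hyp : 0 < ‖spacePart y‖ := norm_pos_iff.2 hy
          gcongr ?_ * ?_
          · gcongr; simp [wA]
          · rw [norm_sq4, PiLp.add_apply]
            have h3 : ((x 0 + y 0) ^ 2 + R ^ 2) / 4 ≤
                (x 0 + y 0) ^ 2 + ‖spacePart (x + y)‖ ^ 2 := by
              nlinarith [h.2, norm_nonneg (spacePart (x + y)), sq_nonneg (x 0 + y 0)]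
            calc ((x 0 + y 0) ^ 2 + ‖spacePart (x + y)‖ ^ 2)⁻¹ ≤
                (((x 0 + y 0) ^ 2 + R ^ 2) / 4)⁻¹ := by gcongr
              _ = _ := by rw [inv_div]; ring
        · simp
    _ = ∫⁻ ξ : E3, ∫⁻ τ : ℝ, (ENNReal.ofReal (‖ξ‖⁻¹ ^ 2) *
        (Set.Icc 0 R).indicator 1 ‖ξ‖) * ENNReal.ofReal (4 * ((x 0 + τ) ^ 2 + R ^ 2)⁻¹) := by
        rw [split4 (fun τ ξ => (ENNReal.ofReal (‖ξ‖⁻¹ ^ 2) *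
          (Set.Icc 0 R).indicator 1 ‖ξ‖) * ENNReal.ofReal (4 * ((x 0 + τ) ^ 2 + R ^ 2)⁻¹))
          (by fun_prop)]
    _ = ∫⁻ ξ : E3, (ENNReal.ofReal (‖ξ‖⁻¹ ^ 2) *
        (Set.Icc 0 R).indicator 1 ‖ξ‖) * ∫⁻ τ : ℝ, ENNReal.ofReal (4 * (τ ^ 2 + R ^ 2)⁻¹) := by
        congr 1; ext ξ
        rw [lintegral_const_mul _ (by fun_prop),
          lintegral_add_left_eq_self (fun τ : ℝ => ENNReal.ofReal (4 * (τ ^ 2 + R ^ 2)⁻¹))]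
    _ ≤ ENNReal.ofReal (8 * Real.pi * R) * (ENNReal.ofReal 4 * ENNReal.ofReal (Real.pi * R⁻¹)) := by
        rw [lintegral_mul_const _ (by fun_prop)]
        gcongr ?_ * ?_
        · exact ball_two R
        · simp_rw [ENNReal.ofReal_mul (show (0 : ℝ) ≤ 4 by norm_num)]
          rw [lintegral_const_mul' _ _ (by finiteness)]
          refine mul_le_mul' le_rfl ?_
          exact lorentz R hRp
    _ ≤ _ := by
        rw [← ENNReal.ofReal_mul (by positivity), ← ENNReal.ofReal_mul (by positivity)]
        apply ENNReal.ofReal_le_ofReal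
        apply le_of_eq
        field_simp
        ring

theorem kB_le (x y : E4) : kB x y ≤ kB1 x y + kB2 x y := by
  have hA := one_le_wA y
  have p : 0 ≤ ‖x + y‖⁻¹ * wA y ^ (-(1 / 2) : ℝ) := by positivity
  unfold kB kB1 kB2
  split_ifs with h1 h2 h3 h3 h4 h5
  all_goals try linarith
  exfalso
  apply h3
  refine ⟨h1, ?_⟩
  have : ‖spacePart x‖ ≤ ‖spacePart (x + y)‖ + ‖spacePart y‖ := by
    have h6 : spacePart x = spacePart (x + y) - spacePart y := by rw [spacePart_add]; simp
    calc ‖spacePart x‖ = ‖spacePart (x + y) - spacePart y‖ := by rw [← h6]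
      _ ≤ _ := norm_sub_le _ _
  linarith

theorem le_of_sq_le_sq4 {x y : ℝ} (h : x ^ 2 ≤ y ^ 2) (hy : 0 ≤ y) : x ≤ y :=
  le_of_abs_le (by rw [← abs_of_nonneg hy]; exact sq_le_sq.1 (by simpa [abs_of_nonneg hy] using h))

/-- total weight -/
def wt (b : ℝ) (ζ : E4) : ℝ := wA ζ ^ (1 / 2 : ℝ) * wB ζ ^ (b / 2)

theorem wt_pos (b : ℝ) (ζ : E4) : 0 < wt b ζ := by
  have := one_le_wA ζ
  have := one_le_wB ζ
  unfold wt; positivity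

@[fun_prop]
theorem measurable_wt (b : ℝ) : Measurable (wt b) := by unfold wt; fun_prop

theorem hN_nonneg (b : ℝ) (ζ : E4) : 0 ≤ hN b ζ := by
  have := one_le_wA ζ
  have := one_le_wB ζ
  unfold hN; positivity

theorem hP_nonneg (b : ℝ) (ζ : E4) : 0 ≤ hP b ζ := by
  have := one_le_wA ζ
  have := one_le_wP ζ
  unfold hP; positivity

theorem kA_nonneg (b : ℝ) (x y : E4) : 0 ≤ kA b x y := by
  have := one_le_wA y
  have := one_le_wB x
  unfold kA; positivity

theorem kB_nonneg (x y : E4) : 0 ≤ kB x y := by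
  have := one_le_wA y
  unfold kB
  split_ifs <;> positivity

theorem wt_hN (b : ℝ) (x : E4) : wt b x * hN b x = wA x ^ (1 / 4 : ℝ) := by
  have h1 := one_le_wA x
  have h2 := one_le_wB x
  unfold wt hN
  rw [mul_mul_mul_comm, ← Real.rpow_add (by positivity), ← Real.rpow_add (by positivity),
    show b / 2 + -b / 2 = 0 by ring, Real.rpow_zero, mul_one]
  norm_num

/-- far from the cone -/
def far (x : E4) : Prop := 4 * wA x < x 0 ^ 2

theorem far_wB (x : E4) (h : far x) : x 0 ^ 2 / 4 ≤ wB x := by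
  unfold far wA at h
  unfold wB
  have h0 := norm_nonneg (spacePart x)
  have h1 : 2 * ‖spacePart x‖ ≤ |x 0| := by
    apply le_of_sq_le_sq4 _ (abs_nonneg _)
    rw [sq_abs]; nlinarith
  have h2 : x 0 ^ 2 = |x 0| ^ 2 := (sq_abs _).symm
  rw [h2]
  nlinarith

theorem far_wAB (x : E4) (h : far x) : wA x ≤ wB x := by
  have := far_wB x h
  unfold far at h
  linarith

theorem wt_kA (b : ℝ) (hb : 1 / 2 < b) (x y : E4) (h : far y) :
    wA x ^ (1 / 2 : ℝ) ≤ wt b x * wt b y * kA b x y := by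
  have h1 := one_le_wA x
  have h2 := one_le_wB x
  have h3 := one_le_wA y
  have h4 := one_le_wB y
  have e1 : wB x ^ (b / 2) * wB x ^ (-b / 2) = 1 := by
    rw [← Real.rpow_add (by positivity), show b / 2 + -b / 2 = 0 by ring, Real.rpow_zero]
  have e2 : wA y ^ (1 / 2 : ℝ) * wA y ^ (-(1 + b) / 2) = wA y ^ (-(b / 2)) := by
    rw [← Real.rpow_add (by positivity)]; congr 1; ring
  have e3 : wA y ^ (-(b / 2)) * wA y ^ (b / 2) = 1 := by
    rw [← Real.rpow_add (by positivity), neg_add_cancel, Real.rpow_zero]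
  unfold wt kA
  calc wA x ^ (1 / 2 : ℝ) = wA x ^ (1 / 2 : ℝ) * (wA y ^ (-(b / 2)) * wA y ^ (b / 2)) := by
        rw [e3, mul_one]
    _ ≤ wA x ^ (1 / 2 : ℝ) * (wA y ^ (-(b / 2)) * wB y ^ (b / 2)) := by
        gcongr
        exact far_wAB y h
    _ = wA x ^ (1 / 2 : ℝ) * ((wA y ^ (1 / 2 : ℝ) * wA y ^ (-(1 + b) / 2)) * wB y ^ (b / 2)) *
          (wB x ^ (b / 2) * wB x ^ (-b / 2)) := by
        rw [e1, e2, mul_one]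
    _ = _ := by ring

theorem wt_kB (b : ℝ) (x y : E4) (h : ‖spacePart y‖ ≤ ‖spacePart x‖) :
    wA x ^ (1 / 2 : ℝ) * (wB x ^ (b / 2) * wB y ^ (b / 2)) * ‖x + y‖⁻¹ =
      wt b x * wt b y * kB x y := by
  have h3 := one_le_wA y
  have e1 : wA y ^ (1 / 2 : ℝ) * wA y ^ (-(1 / 2) : ℝ) = 1 := by
    rw [← Real.rpow_add (by positivity), add_neg_cancel, Real.rpow_zero]
  unfold wt kB
  rw [if_pos h]
  linear_combination (-(wA x ^ (1 / 2 : ℝ) * (wB x ^ (b / 2) * wB y ^ (b / 2)) * ‖x + y‖⁻¹)) * e1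

/-- symbol of the null form -/
def qs (i : Fin 3) (x y : E4) : ℝ := x 0 * y i.succ - x i.succ * y 0

theorem abs_coord_le (i : Fin 3) (x : E4) : |x i.succ| ≤ ‖spacePart x‖ := by
  have := PiLp.norm_apply_le (spacePart x) i
  simpa [spacePart] using this

theorem norm_le_of_near (x : E4) (h : ¬ far x) : ‖x‖ ≤ 3 * wA x ^ (1 / 2 : ℝ) := by
  have h1 := one_le_wA x
  rw [← Real.sqrt_eq_rpow]
  apply le_of_sq_le_sq4 _ (by positivity)
  rw [mul_pow, Real.sq_sqrt (by positivity), norm_sq4]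
  unfold far at h
  have : ‖spacePart x‖ ^ 2 ≤ wA x := by unfold wA; linarith
  linarith

theorem coord_sq_le (i : Fin 3) (x : E4) : x 0 ^ 2 + x i.succ ^ 2 ≤ ‖x‖ ^ 2 := by
  rw [norm_sq4]
  have := abs_coord_le i x
  have := sq_le_sq' (by linarith [abs_nonneg (x i.succ), norm_nonneg (spacePart x)]) this
  rw [sq_abs] at this
  linarith

theorem qs_le_aux (i : Fin 3) (x y : E4) :
    |x 0 * y i.succ - x i.succ * y 0| ≤ ‖x‖ * ‖y‖ := by
  apply le_of_sq_le_sq4 _ (by positivity)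
  rw [sq_abs, mul_pow]
  calc _ ≤ (x 0 ^ 2 + x i.succ ^ 2) * (y 0 ^ 2 + y i.succ ^ 2) := by
        nlinarith [sq_nonneg (x 0 * y 0 + x i.succ * y i.succ)]
    _ ≤ _ := by
        gcongr <;> exact coord_sq_le i _

theorem qs_div_le_left (i : Fin 3) (x y : E4) : |qs i x y| * ‖x + y‖⁻¹ ≤ ‖x‖ := by
  have h := qs_le_aux i x (x + y)
  have e : x 0 * (x + y) i.succ - x i.succ * (x + y) 0 = qs i x y := by
    unfold qs; simp; ring
  rw [e] at h
  rcases eq_or_ne ‖x + y‖ 0 with h0 | h0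
  · rw [h0]; simp
  · have : 0 < ‖x + y‖ := lt_of_le_of_ne (norm_nonneg _) h0.symm
    rw [← div_eq_mul_inv, div_le_iff₀ this]
    exact h

theorem qs_swap (i : Fin 3) (x y : E4) : |qs i y x| = |qs i x y| := by
  rw [← abs_neg]; congr 1; unfold qs; ring

theorem qs_div_le_right (i : Fin 3) (x y : E4) : |qs i x y| * ‖x + y‖⁻¹ ≤ ‖y‖ := by
  rw [← qs_swap, add_comm]
  exact qs_div_le_left i y x

theorem le_mul_of_le_sq (k u v : ℝ) (hk : 0 ≤ k) (hu : 0 ≤ u) (hv : 0 ≤ v) (h1 : k ≤ 3 * u ^ 2)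
    (h2 : k ≤ 3 * v ^ 2) : k ≤ 3 * (u * v) := by
  apply le_of_sq_le_sq4 _ (by positivity)
  calc k ^ 2 = k * k := sq k
    _ ≤ (3 * u ^ 2) * (3 * v ^ 2) := by gcongr
    _ = _ := by ring

theorem quarter_sq (x : E4) : wA x ^ (1 / 2 : ℝ) = (wA x ^ (1 / 4 : ℝ)) ^ 2 := by
  have h1 := one_le_wA x
  rw [← Real.rpow_natCast, ← Real.rpow_mul (by positivity)]
  norm_num

theorem ker_ff (b : ℝ) (hb : 1 / 2 < b) (i : Fin 3) (x y : E4) (hx : far x) (hy : far y)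
    (hxy : ‖spacePart y‖ ≤ ‖spacePart x‖) :
    |qs i x y| * ‖x + y‖⁻¹ ≤ 8 * (wt b x * wt b y * (kA b x y + kB x y)) := by
  have hw := mul_pos (wt_pos b x) (wt_pos b y)
  have hA := wt_kA b hb x y hy
  have hB := wt_kB b x y hxy
  have pA := mul_nonneg hw.le (kA_nonneg b x y)
  have pB := mul_nonneg hw.le (kB_nonneg x y)
  have h1 := one_le_wA x
  set m := max |x 0| |y 0| with hm
  have hmx : |x 0| ≤ m := le_max_left _ _
  have hmy : |y 0| ≤ m := le_max_right _ _
  have hm0 : 0 < m := by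
    refine lt_of_lt_of_le ?_ hmx
    rw [abs_pos]
    intro h0
    unfold far at hx
    rw [h0] at hx
    linarith
  have hJ : ‖spacePart x‖ ≤ wA x ^ (1 / 2 : ℝ) := by
    rw [← Real.sqrt_eq_rpow]
    apply Real.le_sqrt_of_sq_le
    unfold wA; linarith
  have hq : |qs i x y| ≤ 2 * m * wA x ^ (1 / 2 : ℝ) := by
    have a1 := abs_coord_le i x
    have a2 := abs_coord_le i y
    calc |qs i x y| ≤ |x 0 * y i.succ| + |x i.succ * y 0| := abs_sub _ _
      _ = |x 0| * |y i.succ| + |x i.succ| * |y 0| := by rw [abs_mul, abs_mul]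
      _ ≤ m * wA x ^ (1 / 2 : ℝ) + wA x ^ (1 / 2 : ℝ) * m := by
          gcongr <;> linarith
      _ = _ := by ring
  rcases le_or_gt (m / 2) |x 0 + y 0| with hc | hc
  · have hn : m / 2 ≤ ‖x + y‖ := by
      refine hc.trans ?_
      have := PiLp.norm_apply_le (x + y) 0
      simpa using this
    have : |qs i x y| * ‖x + y‖⁻¹ ≤ 4 * wA x ^ (1 / 2 : ℝ) := by
      calc _ ≤ (2 * m * wA x ^ (1 / 2 : ℝ)) * (m / 2)⁻¹ := by gcongr
        _ = _ := by field_simp; ring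
    nlinarith
  · have hx2 : m / 2 ≤ |x 0| := by
      rcases max_choice |x 0| |y 0| with h | h
      · rw [hm, h]; linarith [abs_nonneg (x 0)]
      · have : |y 0| ≤ |x 0 + y 0| + |x 0| := by
          calc |y 0| = |(x 0 + y 0) - x 0| := by congr 1; ring
            _ ≤ _ := abs_sub _ _
        rw [← hm] at h; linarith
    have hy2 : m / 2 ≤ |y 0| := by
      rcases max_choice |x 0| |y 0| with h | h
      · have : |x 0| ≤ |x 0 + y 0| + |y 0| := by
          calc |x 0| = |(x 0 + y 0) - y 0| := by congr 1; ring
            _ ≤ _ := abs_sub _ _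
        rw [← hm] at h; linarith
      · rw [hm, h]; linarith [abs_nonneg (y 0)]
    have aux : ∀ z : E4, far z → m / 2 ≤ |z 0| → (m / 4) ^ (1 / 2 : ℝ) ≤ wB z ^ (b / 2) := by
      intro z hz hz2
      have hB := far_wB z hz
      have hB1 := one_le_wB z
      have h3 : (m / 4) ^ 2 ≤ wB z := by
        refine le_trans ?_ hB
        rw [← sq_abs (z 0)]
        nlinarith
      calc (m / 4) ^ (1 / 2 : ℝ) = ((m / 4) ^ 2) ^ (1 / 4 : ℝ) := by
            rw [← Real.rpow_natCast, ← Real.rpow_mul (by positivity)]; norm_num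
        _ ≤ wB z ^ (1 / 4 : ℝ) := by gcongr
        _ ≤ _ := Real.rpow_le_rpow_of_exponent_le hB1 (by linarith)
    have hBB : m / 4 ≤ wB x ^ (b / 2) * wB y ^ (b / 2) := by
      calc m / 4 = (m / 4) ^ (1 / 2 : ℝ) * (m / 4) ^ (1 / 2 : ℝ) := by
            rw [← Real.rpow_add (by positivity)]; norm_num
        _ ≤ _ := by
            have := one_le_wB x
            gcongr
            · exact aux x hx hx2
            · exact aux y hy hy2
    have : |qs i x y| * ‖x + y‖⁻¹ ≤ 8 * (wt b x * wt b y * kB x y) := by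
      rw [← hB]
      calc _ ≤ (2 * m * wA x ^ (1 / 2 : ℝ)) * ‖x + y‖⁻¹ := by gcongr
        _ = 8 * (wA x ^ (1 / 2 : ℝ) * (m / 4) * ‖x + y‖⁻¹) := by ring
        _ ≤ _ := by gcongr
    nlinarith

theorem ker_le (b : ℝ) (hb : 1 / 2 < b) (i : Fin 3) (x y : E4) :
    |qs i x y| * ‖x + y‖⁻¹ ≤ 8 * (wt b x * wt b y *
      (hN b x * hN b y + (kA b x y + kB x y) + (kA b y x + kB y x))) := by
  have hw := mul_pos (wt_pos b x) (wt_pos b y)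
  have pN := mul_nonneg hw.le (mul_nonneg (hN_nonneg b x) (hN_nonneg b y))
  have pA := mul_nonneg hw.le (kA_nonneg b x y)
  have pB := mul_nonneg hw.le (kB_nonneg x y)
  have pA' := mul_nonneg hw.le (kA_nonneg b y x)
  have pB' := mul_nonneg hw.le (kB_nonneg y x)
  have q1 := qs_div_le_left i x y
  have q2 := qs_div_le_right i x y
  have q0 : 0 ≤ |qs i x y| * ‖x + y‖⁻¹ := by positivity
  simp only [mul_add] at *
  by_cases hx : far x <;> by_cases hy : far y
  · rcases le_total ‖spacePart y‖ ‖spacePart x‖ with h | h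
    · have := ker_ff b hb i x y hx hy h
      linarith
    · have := ker_ff b hb i y x hy hx h
      rw [qs_swap, add_comm y x, mul_comm (wt b y)] at this
      linarith
  · have h1 := norm_le_of_near y hy
    have h2 := wt_kA b hb y x hx
    rw [mul_comm (wt b y)] at h2
    linarith
  · have h1 := norm_le_of_near x hx
    have h2 := wt_kA b hb x y hy
    linarith
  · have h1 := norm_le_of_near x hx
    have h2 := norm_le_of_near y hy
    have a1 := one_le_wA x
    have a2 := one_le_wA y
    rw [quarter_sq] at h1 h2
    have := le_mul_of_le_sq _ _ _ q0 (by positivity : 0 ≤ wA x ^ (1 / 4 : ℝ))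
      (by positivity : 0 ≤ wA y ^ (1 / 4 : ℝ)) (q1.trans h1) (q2.trans h2)
    rw [← wt_hN b x, ← wt_hN b y] at this
    have e : wt b x * hN b x * (wt b y * hN b y) = wt b x * wt b y * (hN b x * hN b y) := by ring
    rw [e] at this
    linarith

/-! ### Combining the bilinear bounds -/

/-- boundedness of a bilinear kernel -/
def Bdd (K : E4 → E4 → ℝ≥0∞) : Prop :=
  ∃ C : ℝ≥0∞, C ≠ ∞ ∧ ∀ f g : E4 → ℝ≥0∞, Measurable f → Measurable g →
    bil K f g ≤ C * sqn f * sqn g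

theorem Bdd.mono {K K' : E4 → E4 → ℝ≥0∞} (h : Bdd K') (hle : ∀ a b, K a b ≤ K' a b) : Bdd K := by
  obtain ⟨C, hC, H⟩ := h
  exact ⟨C, hC, fun f g hf hg => (bil_mono K K' f g hle).trans (H f g hf hg)⟩

theorem Bdd.add {K K' : E4 → E4 → ℝ≥0∞} (h : Bdd K) (h' : Bdd K')
    (hK : Measurable fun p : E4 × E4 => K p.1 p.2) : Bdd (fun a b => K a b + K' a b) := by
  obtain ⟨C, hC, H⟩ := h
  obtain ⟨C', hC', H'⟩ := h'
  refine ⟨3 * (C + C'), by finiteness, fun f g hf hg => ?_⟩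
  calc _ ≤ 3 * (bil K f g + bil K' f g) := bil_add K K' f g hK hf hg
    _ ≤ 3 * (C * sqn f * sqn g + C' * sqn f * sqn g) :=
        mul_le_mul' le_rfl (add_le_add (H f g hf hg) (H' f g hf hg))
    _ = _ := by ring

theorem Bdd.swap {K : E4 → E4 → ℝ≥0∞} (h : Bdd K) : Bdd (fun a b => K b a) := by
  obtain ⟨C, hC, H⟩ := h
  refine ⟨C, hC, fun f g hf hg => ?_⟩
  rw [← bil_swap]
  exact (H g f hg hf).trans_eq (by ring)

theorem sqn_neg (f : E4 → ℝ≥0∞) : sqn (fun x => f (-x)) = sqn f := by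
  unfold sqn
  exact lintegral_neg_eq_self (μ := volume) (fun x => f x ^ 2)

theorem bil_prod (p q f g : E4 → ℝ≥0∞) :
    bil (fun x y => p x * q y) f g = cv (fun x => p x * f x) (fun x => q x * g x) := by
  unfold bil cv
  congr 1; ext ζ
  congr 2; ext η
  ring

theorem Bdd.reflect {p q : E4 → ℝ≥0∞} (hp : Measurable p) (hq : Measurable q)
    (h : Bdd (fun x y => p x * q y)) : Bdd (fun x y => p x * q (-y)) := by
  obtain ⟨C, hC, H⟩ := h
  refine ⟨C, hC, fun f g hf hg => ?_⟩
  have e := cv_reflect (fun x => p x * f x) (fun x => q x * g (-x)) (by fun_prop) (by fun_prop)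
  simp only [neg_neg] at e
  rw [bil_prod p (fun y => q (-y)), e, ← bil_prod p q f (fun x => g (-x)), ← sqn_neg g]
  exact H f _ hf (by fun_prop)

theorem hN_le (b : ℝ) (ζ : E4) : hN b ζ ≤ hP b ζ + hP b (-ζ) := by
  have hA : wA (-ζ) = wA ζ := by simp [wA, spacePart_neg]
  rcases le_total 0 (ζ 0) with h | h
  · have : hN b ζ = hP b ζ := by simp [hN, hP, wB, wP, abs_of_nonneg h]
    have := hP_nonneg b (-ζ)
    linarith
  · have : hN b ζ = hP b (-ζ) := by simp [hN, hP, wB, wP, abs_of_nonpos h, hA, spacePart_neg]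
    have := hP_nonneg b ζ
    linarith

theorem bdd_hP (b : ℝ) (hb : 1 / 2 < b) :
    Bdd (fun x y => ENNReal.ofReal (hP b x) * ENNReal.ofReal (hP b y)) := by
  have hc := cmod_lt b hb
  have hc' := hc.ne
  exact ⟨_, by finiteness, fun f g hf hg => bil_le_out _ f g (by fun_prop) hf hg _ (hP_int b hb)⟩

theorem bdd_hN (b : ℝ) (hb : 1 / 2 < b) :
    Bdd (fun x y => ENNReal.ofReal (hN b x * hN b y)) := by
  let p : E4 → ℝ≥0∞ := fun x => ENNReal.ofReal (hP b x)
  let m : E4 → ℝ≥0∞ := fun x => ENNReal.ofReal (hP b (-x))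
  have hp : Measurable p := by fun_prop
  have hm : Measurable m := by fun_prop
  have h1 : Bdd (fun x y => p x * p y) := bdd_hP b hb
  have h2 : Bdd (fun x y => p x * m y) := Bdd.reflect hp hp h1
  have h3 : Bdd (fun x y => m x * p y) := by
    have := h2.swap
    exact this.mono fun a b => (mul_comm _ _).le
  have h4 : Bdd (fun x y => m x * m y) := Bdd.reflect hm hp h3
  refine (((h1.add h2 (by fun_prop)).add h3 (by fun_prop)).add h4 (by fun_prop)).mono fun x y => ?_
  have key : ∀ x, ENNReal.ofReal (hN b x) ≤ p x + m x := fun x =>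
    (ENNReal.ofReal_le_ofReal (hN_le b x)).trans ENNReal.ofReal_add_le
  rw [ENNReal.ofReal_mul (hN_nonneg b x)]
  exact (mul_le_mul' (key x) (key y)).trans_eq (by ring)

theorem bdd_kA (b : ℝ) (hb : 1 / 2 < b) : Bdd (fun x y => ENNReal.ofReal (kA b x y)) := by
  have hc := (cmod_lt b hb).ne
  have hc' := (cspace_lt b hb).ne
  exact ⟨_, by finiteness, fun f g hf hg => bil_le_out _ f g
    (ENNReal.measurable_ofReal.comp (measurable_kA b)) hf hg _ (kA_int b)⟩

theorem bdd_kB : Bdd (fun x y => ENNReal.ofReal (kB x y)) := by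
  have h1 : Bdd (fun x y => ENNReal.ofReal (kB1 x y)) :=
    ⟨_, by finiteness, fun f g hf hg => bil_le_right _ f g
      (ENNReal.measurable_ofReal.comp measurable_kB1) hf hg _ kB1_int⟩
  have h2 : Bdd (fun x y => ENNReal.ofReal (kB2 x y)) :=
    ⟨_, by finiteness, fun f g hf hg => bil_le_left _ f g
      (ENNReal.measurable_ofReal.comp measurable_kB2) hf hg _ kB2_int⟩
  refine (h1.add h2 (ENNReal.measurable_ofReal.comp measurable_kB1)).mono fun x y => ?_
  exact (ENNReal.ofReal_le_ofReal (kB_le x y)).trans ENNReal.ofReal_add_le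

/-- the full kernel -/
def kT (b : ℝ) (x y : E4) : ℝ :=
  hN b x * hN b y + (kA b x y + kB x y) + (kA b y x + kB y x)

theorem bdd_kT (b : ℝ) (hb : 1 / 2 < b) : Bdd (fun x y => ENNReal.ofReal (kT b x y)) := by
  have mA : Measurable fun p : E4 × E4 => ENNReal.ofReal (kA b p.1 p.2) :=
    ENNReal.measurable_ofReal.comp (measurable_kA b)
  have mB : Measurable fun p : E4 × E4 => ENNReal.ofReal (kB p.1 p.2) :=
    ENNReal.measurable_ofReal.comp measurable_kB
  have hAB := (bdd_kA b hb).add bdd_kB mA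
  have mN : Measurable fun p : E4 × E4 => ENNReal.ofReal (hN b p.1 * hN b p.2) := by fun_prop
  refine (((bdd_hN b hb).add hAB mN).add hAB.swap (mN.add (mA.add mB))).mono fun x y => ?_
  refine ENNReal.ofReal_add_le.trans (add_le_add ?_ ENNReal.ofReal_add_le)
  exact ENNReal.ofReal_add_le.trans (add_le_add le_rfl ENNReal.ofReal_add_le)

/-! ### The Fourier side -/

theorem fourierInv_eq_neg (h : SchwartzMap E4 ℂ) (x : E4) : (𝓕⁻ h) x = (𝓕 h) (-x) := by
  rw [SchwartzMap.fourierInv_apply_eq]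
  rfl

/-- pointwise product of Schwartz functions -/
def sprod (f g : SchwartzMap E4 ℂ) : SchwartzMap E4 ℂ :=
  SchwartzMap.pairing (ContinuousLinearMap.mul ℂ ℂ) f g

theorem sprod_apply (f g : SchwartzMap E4 ℂ) (x : E4) : sprod f g x = f x * g x := by
  simp [sprod, SchwartzMap.pairing_apply_apply]

theorem fourier_sprod (f g : SchwartzMap E4 ℂ) (ζ : E4) :
    𝓕 (sprod f g) ζ = ∫ η, 𝓕 f η * 𝓕 g (ζ - η) := by
  have h1 : 𝓕⁻ (sprod f g) =
      SchwartzMap.convolution (ContinuousLinearMap.mul ℂ ℂ) (𝓕⁻ f) (𝓕⁻ g) := by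
    have := SchwartzMap.fourier_convolution (ContinuousLinearMap.mul ℂ ℂ) (𝓕⁻ f) (𝓕⁻ g)
    simp only [FourierTransform.fourier_fourierInv_eq] at this
    rw [sprod, ← this, FourierTransform.fourierInv_fourier_eq]
  have h2 := congrArg (fun h : SchwartzMap E4 ℂ => h (-ζ)) h1
  simp only [SchwartzMap.convolution_apply] at h2
  rw [fourierInv_eq_neg, neg_neg] at h2
  rw [h2, MeasureTheory.convolution, ← integral_neg_eq_self]
  congr 1; ext η
  simp only [fourierInv_eq_neg, ContinuousLinearMap.mul_apply', neg_neg]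
  congr 2
  abel

open LineDeriv in
/-- partial derivative of a Schwartz function -/
def spd (i : Fin 4) (f : SchwartzMap E4 ℂ) : SchwartzMap E4 ℂ :=
  ∂_{(EuclideanSpace.single i 1 : E4)} f

theorem spd_apply (i : Fin 4) (f : SchwartzMap E4 ℂ) (x : E4) : spd i f x = pderiv i f x := by
  rw [spd, SchwartzMap.lineDerivOp_apply_eq_fderiv]; rfl

theorem fourier_spd (i : Fin 4) (f : SchwartzMap E4 ℂ) (ζ : E4) :
    𝓕 (spd i f) ζ = (2 * Real.pi * Complex.I) * (ζ i : ℂ) * 𝓕 f ζ := by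
  rw [spd, SchwartzMap.fourier_lineDerivOp_eq]
  have : (fun x : E4 => inner ℝ x (EuclideanSpace.single i (1 : ℝ))).HasTemperateGrowth :=
    ((innerSL ℝ).flip (EuclideanSpace.single i (1 : ℝ) : E4)).hasTemperateGrowth
  rw [smul_apply, SchwartzMap.smulLeftCLM_apply_apply this]
  simp [EuclideanSpace.inner_single_right]
  ring

theorem integrable_conv (F G : SchwartzMap E4 ℂ) (ζ : E4) :
    Integrable fun η => F η * G (ζ - η) := by
  refine F.integrable.mul_bdd (c := SchwartzMap.seminorm ℝ 0 0 G) ?_ ?_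
  · exact (G.continuous.comp (by fun_prop)).aestronglyMeasurable
  · exact Filter.Eventually.of_forall fun x => SchwartzMap.norm_le_seminorm ℝ G _

theorem fourier_nullForm (i : Fin 3) (u v : SchwartzMap E4 ℂ) (ζ : E4) :
    𝓕 (nullFormQ0i i (⇑u) (⇑v)) ζ =
      ∫ η, (-(4 * Real.pi ^ 2) : ℂ) * ((qs i η (ζ - η) : ℝ) : ℂ) * (𝓕 u η * 𝓕 v (ζ - η)) := by
  have e : nullFormQ0i i (⇑u) (⇑v) =
      ⇑(sprod (spd 0 u) (spd i.succ v) - sprod (spd i.succ u) (spd 0 v)) := by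
    ext x
    simp [nullFormQ0i, sprod_apply, spd_apply]
  rw [e, ← SchwartzMap.fourier_coe, sub_eq_add_neg, FourierTransform.fourier_add,
    FourierTransform.fourier_neg, ← sub_eq_add_neg, sub_apply, fourier_sprod, fourier_sprod,
    ← integral_sub (integrable_conv _ _ ζ) (integrable_conv _ _ ζ)]
  congr 1; ext η
  simp only [fourier_spd, qs]
  push_cast
  linear_combination (4 * (Real.pi : ℂ) ^ 2 * (𝓕 u η * 𝓕 v (ζ - η)) *
    (η 0 * (ζ - η) i.succ - η i.succ * (ζ - η) 0)) * Complex.I_sq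

theorem enorm_nullForm_le (i : Fin 3) (u v : SchwartzMap E4 ℂ) (ζ : E4) :
    ‖𝓕 (nullFormQ0i i (⇑u) (⇑v)) ζ‖ₑ ≤
      ∫⁻ η, ENNReal.ofReal (4 * Real.pi ^ 2 * |qs i η (ζ - η)| * (‖𝓕 u η‖ * ‖𝓕 v (ζ - η)‖)) := by
  rw [fourier_nullForm]
  refine (enorm_integral_le_lintegral_enorm _).trans_eq ?_
  congr 1; ext η
  rw [← ofReal_norm]
  congr 1
  simp [abs_of_pos Real.pi_pos]

/-! ### Conclusion -/

/-- integrand of the squared wave-Sobolev norm -/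
def wint (b : ℝ) (u : SchwartzMap E4 ℂ) (ζ : E4) : ℝ :=
  (1 + ‖spacePart ζ‖ ^ 2) ^ (1 : ℝ) * (1 + (|ζ 0| - ‖spacePart ζ‖) ^ 2) ^ b * ‖𝓕 u ζ‖ ^ 2

theorem wint_eq (b : ℝ) (u : SchwartzMap E4 ℂ) (ζ : E4) :
    wint b u ζ = wA ζ ^ (1 : ℝ) * wB ζ ^ b * ‖𝓕 u ζ‖ ^ 2 := rfl

theorem wint_nonneg (b : ℝ) (u : SchwartzMap E4 ℂ) (ζ : E4) : 0 ≤ wint b u ζ := by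
  unfold wint; positivity

theorem measurable_fourier (u : SchwartzMap E4 ℂ) : Measurable (fun x => 𝓕 u x) := (𝓕 u).continuous.measurable

theorem wint_sq (b : ℝ) (u : SchwartzMap E4 ℂ) (ζ : E4) :
    (wt b ζ * ‖𝓕 u ζ‖) ^ 2 = wint b u ζ := by
  have h1 := one_le_wA ζ
  have h2 := one_le_wB ζ
  rw [wint_eq, wt, mul_pow, mul_pow, ← Real.rpow_mul_natCast (by linarith),
    ← Real.rpow_mul_natCast (by linarith)]
  norm_num

theorem integrable_wint (b : ℝ) (hb : 1 / 2 < b) (u : SchwartzMap E4 ℂ) :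
    Integrable (wint b u) := by
  let W : SchwartzMap E4 ℂ :=
    SchwartzMap.smulLeftCLM ℂ (fun x : E4 => (1 + ‖x‖ ^ 2) ^ (1 + b)) (𝓕 u)
  have hW : ∀ x, W x = ((1 + ‖x‖ ^ 2) ^ (1 + b) : ℝ) • 𝓕 u x := fun x =>
    SchwartzMap.smulLeftCLM_apply_apply
      (Function.hasTemperateGrowth_one_add_norm_sq_rpow E4 (1 + b)) _ _
  refine (sprod W (𝓕 u)).integrable.mono ?_ (Filter.Eventually.of_forall fun ζ => ?_)
  · have := measurable_fourier u
    unfold wint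
    exact Measurable.aestronglyMeasurable (by fun_prop)
  · have h1 := one_le_wA ζ
    have h2 := one_le_wB ζ
    have hn := norm_sq4 ζ
    rw [Real.norm_of_nonneg (wint_nonneg b u ζ), sprod_apply, hW, norm_mul, norm_smul,
      Real.norm_of_nonneg (by positivity), wint_eq, mul_assoc _ ‖𝓕 u ζ‖, ← sq]
    have hA : wA ζ ≤ 1 + ‖ζ‖ ^ 2 := by unfold wA; nlinarith [sq_nonneg (ζ 0)]
    have hB : wB ζ ≤ 1 + ‖ζ‖ ^ 2 := by
      unfold wB
      nlinarith [mul_nonneg (abs_nonneg (ζ 0)) (norm_nonneg (spacePart ζ)), sq_abs (ζ 0)]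
    rw [Real.rpow_add (by positivity)]
    gcongr

theorem ofReal_homint_le (b : ℝ) (hb : 1 / 2 < b) (i : Fin 3) (u v : SchwartzMap E4 ℂ) (ζ : E4) :
    ENNReal.ofReal (‖ζ‖ ^ (2 * (-1) : ℝ) * ‖𝓕 (nullFormQ0i i (⇑u) (⇑v)) ζ‖ ^ 2) ≤
      (∫⁻ η, ENNReal.ofReal (32 * Real.pi ^ 2) * ENNReal.ofReal (kT b η (ζ - η)) *
        ENNReal.ofReal (wt b η * ‖𝓕 u η‖) *
        ENNReal.ofReal (wt b (ζ - η) * ‖𝓕 v (ζ - η)‖)) ^ 2 := by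
  have e : ‖ζ‖ ^ (2 * (-1) : ℝ) * ‖𝓕 (nullFormQ0i i (⇑u) (⇑v)) ζ‖ ^ 2 =
      (‖ζ‖⁻¹ * ‖𝓕 (nullFormQ0i i (⇑u) (⇑v)) ζ‖) ^ 2 := by
    rw [mul_pow, mul_comm (2 : ℝ), Real.rpow_mul (norm_nonneg _), Real.rpow_neg_one]
    norm_num
  rw [e, ENNReal.ofReal_pow (by positivity), ENNReal.ofReal_mul (by positivity), ofReal_norm]
  refine pow_le_pow_left' ?_ 2
  refine (mul_le_mul' le_rfl (enorm_nullForm_le i u v ζ)).trans ?_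
  rw [← lintegral_const_mul' _ _ (by finiteness)]
  refine lintegral_mono fun η => ?_
  have hk := ker_le b hb i η (ζ - η)
  have h1 := (wt_pos b η).le
  have h2 := (wt_pos b (ζ - η)).le
  have hkT : 0 ≤ kT b η (ζ - η) := by
    unfold kT
    have a1 := hN_nonneg b η
    have a2 := hN_nonneg b (ζ - η)
    have a3 := kA_nonneg b η (ζ - η)
    have a4 := kA_nonneg b (ζ - η) η
    have a5 := kB_nonneg η (ζ - η)
    have a6 := kB_nonneg (ζ - η) η
    positivity
  rw [← ENNReal.ofReal_mul (by positivity), ← ENNReal.ofReal_mul (by positivity),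
    ← ENNReal.ofReal_mul (by positivity), ← ENNReal.ofReal_mul (by positivity)]
  refine ENNReal.ofReal_le_ofReal ?_
  rw [add_sub_cancel] at hk
  have hk' : |qs i η (ζ - η)| * ‖ζ‖⁻¹ ≤ 8 * (wt b η * wt b (ζ - η) * kT b η (ζ - η)) := hk
  calc ‖ζ‖⁻¹ * (4 * Real.pi ^ 2 * |qs i η (ζ - η)| * (‖𝓕 u η‖ * ‖𝓕 v (ζ - η)‖))
      = 4 * Real.pi ^ 2 * (|qs i η (ζ - η)| * ‖ζ‖⁻¹) * (‖𝓕 u η‖ * ‖𝓕 v (ζ - η)‖) := by ring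
    _ ≤ 4 * Real.pi ^ 2 * (8 * (wt b η * wt b (ζ - η) * kT b η (ζ - η))) *
        (‖𝓕 u η‖ * ‖𝓕 v (ζ - η)‖) := by gcongr
    _ = _ := by ring

theorem sqn_wave (b : ℝ) (hb : 1 / 2 < b) (u : SchwartzMap E4 ℂ) :
    sqn (fun η => ENNReal.ofReal (wt b η * ‖𝓕 u η‖)) = ENNReal.ofReal (∫ ζ, wint b u ζ) := by
  rw [ofReal_integral_eq_lintegral_ofReal (integrable_wint b hb u)
    (Filter.Eventually.of_forall (wint_nonneg b u))]
  unfold sqn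
  congr 1; ext ζ
  have := (wt_pos b ζ).le
  rw [← ENNReal.ofReal_pow (by positivity), wint_sq]

theorem hom_int_le (b : ℝ) (hb : 1 / 2 < b) : ∃ D : ℝ, 0 < D ∧
    ∀ (i : Fin 3) (u v : SchwartzMap E4 ℂ),
      ∫ ζ : E4, ‖ζ‖ ^ (2 * (-1) : ℝ) * ‖𝓕 (nullFormQ0i i (⇑u) (⇑v)) ζ‖ ^ 2 ≤
        D * (∫ ζ, wint b u ζ) * (∫ ζ, wint b v ζ) := by
  obtain ⟨C, hC, H⟩ := bdd_kT b hb
  refine ⟨(32 * Real.pi ^ 2) ^ 2 * (C.toReal + 1), by positivity, fun i u v => ?_⟩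
  have hu : 0 ≤ ∫ ζ, wint b u ζ := integral_nonneg (wint_nonneg b u)
  have hv : 0 ≤ ∫ ζ, wint b v ζ := integral_nonneg (wint_nonneg b v)
  by_cases hJint : Integrable fun ζ : E4 =>
      ‖ζ‖ ^ (2 * (-1) : ℝ) * ‖𝓕 (nullFormQ0i i (⇑u) (⇑v)) ζ‖ ^ 2
  swap
  · rw [integral_undef hJint]; positivity
  have mu := measurable_fourier u
  have mv := measurable_fourier v
  have mw := measurable_wt b
  rw [← ENNReal.ofReal_le_ofReal_iff (by positivity), ofReal_integral_eq_lintegral_ofReal hJint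
    (Filter.Eventually.of_forall fun ζ => by positivity)]
  calc _ ≤ bil (fun x y => ENNReal.ofReal (32 * Real.pi ^ 2) * ENNReal.ofReal (kT b x y))
        (fun η => ENNReal.ofReal (wt b η * ‖𝓕 u η‖))
        (fun η => ENNReal.ofReal (wt b η * ‖𝓕 v η‖)) :=
        lintegral_mono fun ζ => ofReal_homint_le b hb i u v ζ
    _ ≤ ENNReal.ofReal (32 * Real.pi ^ 2) ^ 2 * (C * sqn (fun η => ENNReal.ofReal (wt b η * ‖𝓕 u η‖))
        * sqn (fun η => ENNReal.ofReal (wt b η * ‖𝓕 v η‖))) := by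
        rw [bil_const _ (by finiteness)]
        exact mul_le_mul' le_rfl (H _ _ (by fun_prop) (by fun_prop))
    _ ≤ ENNReal.ofReal (32 * Real.pi ^ 2) ^ 2 * (ENNReal.ofReal (C.toReal + 1) *
          ENNReal.ofReal (∫ ζ, wint b u ζ) * ENNReal.ofReal (∫ ζ, wint b v ζ)) := by
        rw [sqn_wave b hb, sqn_wave b hb]
        gcongr
        conv_lhs => rw [← ENNReal.ofReal_toReal hC]
        exact ENNReal.ofReal_le_ofReal (by linarith)
    _ = _ := by
        rw [← ENNReal.ofReal_pow (by positivity), ← ENNReal.ofReal_mul (by positivity),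
          ← ENNReal.ofReal_mul (by positivity), ← ENNReal.ofReal_mul (by positivity)]
        congr 1; ring

/-- Null form estimate for `Q_{0i}` in wave-Sobolev spaces. -/
theorem nullFormQ0i_estimate (b : ℝ) (hb : 1 / 2 < b) :
    ∃ C > (0 : ℝ), ∀ (i : Fin 3) (u v : SchwartzMap (EuclideanSpace ℝ (Fin 4)) ℂ),
      homSpacetimeNorm (-1) (nullFormQ0i i (⇑u) (⇑v)) ≤
        C * waveSobolevNorm 1 b (⇑u) * waveSobolevNorm 1 b (⇑v) := by
  obtain ⟨D, hD, H⟩ := hom_int_le b hb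
  refine ⟨D ^ (1 / 2 : ℝ), by positivity, fun i u v => ?_⟩
  have hu : 0 ≤ ∫ ζ, wint b u ζ := integral_nonneg (wint_nonneg b u)
  have hv : 0 ≤ ∫ ζ, wint b v ζ := integral_nonneg (wint_nonneg b v)
  have hw : ∀ w : SchwartzMap E4 ℂ,
      waveSobolevNorm 1 b (⇑w) = (∫ ζ, wint b w ζ) ^ (1 / 2 : ℝ) := fun w => rfl
  rw [hw, hw, ← Real.mul_rpow hD.le hu, ← Real.mul_rpow (by positivity) hv]
  unfold homSpacetimeNorm
  exact Real.rpow_le_rpow (integral_nonneg fun ζ => by positivity) (H i u v) (by norm_num)
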